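/- arXiv:1112.2131 — 2 statements merged into one kernel-verified Lean document; each statement's English description precedes it below -/
import Mathlib

section
/- Let k be a field of characteristic zero and let X = V(q) ⊂ ℙⁿ_k be a singular (degenerate) quadric hypersurface, written after diagonalization as q = a₀x₀² + ⋯ + a_r x_r² with r < n and a₀,…,a_r ∈ k, and let Y := V(a₀x₀² + ⋯ + a_r x_r²) ⊂ ℙ^r_k. Then [X] = 1 + 𝕃 + ⋯ + 𝕃^{n−r−1} + 𝕃^{n−r}·[Y] in K₀(Var_k); in particular [X] ≡ 1 mod 𝕃. -/
open AlgebraicGeometry CategoryTheory CategoryTheory.Limits MvPolynomial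

universe u v

noncomputable section

attribute [local instance] MvPolynomial.gradedAlgebra

/-- The base scheme `Spec k`. -/
abbrev SpecBase (k : Type u) [Field k] : Scheme.{u} := Spec (CommRingCat.of k)

/-- The affine line `𝔸¹_k` as a scheme over `k`. -/
def AffineLine (k : Type u) [Field k] : Scheme.{u} := Spec (CommRingCat.of (Polynomial k))

/-- The structure morphism of `𝔸¹_k`. -/
def AffineLine.toSpec (k : Type u) [Field k] : AffineLine k ⟶ SpecBase k :=
  Spec.map (CommRingCat.ofHom (algebraMap k (Polynomial k)))

/-- Projective `n`-space `ℙⁿ_k = Proj k[x₀, …, xₙ]` over `k`. -/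
def ProjSpace (k : Type u) [Field k] (n : ℕ) : Scheme.{u} :=
  Proj (homogeneousSubmodule (Fin (n + 1)) k)

/-- The structure morphism of `ℙⁿ_k`. -/
def ProjSpace.toSpec (k : Type u) [Field k] (n : ℕ) : ProjSpace k n ⟶ SpecBase k :=
  Proj.toSpecZero _ ≫ Spec.map (CommRingCat.ofHom (algebraMap k _))

/-- `X` (a scheme over `k` via `sX : X ⟶ Spec k`) is the reduced closed subvariety of `ℙⁿ_k`
cut out by the family `S` of polynomials, i.e. `X → ℙⁿ_k` is a closed immersion of the reduced
scheme `X` onto the zero locus of `S`, compatibly with the structure morphisms. -/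
def IsProjSubvariety (k : Type u) [Field k] (n : ℕ) (S : Set (MvPolynomial (Fin (n + 1)) k))
    (X : Scheme.{u}) (sX : X ⟶ SpecBase k) : Prop :=
  IsReduced X ∧ ∃ i : X ⟶ ProjSpace k n, IsClosedImmersion i ∧ i ≫ ProjSpace.toSpec k n = sX ∧
    Set.range i.base = ProjectiveSpectrum.zeroLocus (homogeneousSubmodule (Fin (n + 1)) k) S

/-- `X` has a `k`-rational point, i.e. the structure morphism has a section. -/
def HasRatPoint (k : Type u) [Field k] (X : Scheme.{u}) (sX : X ⟶ SpecBase k) : Prop :=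
  ∃ p : SpecBase k ⟶ X, p ≫ sX = 𝟙 (SpecBase k)

/-- A motivic measure on varieties over `k` with values in a commutative ring `R`: an
assignment, to every scheme over `k`, of an element of `R` which, on separated schemes of
finite type over `k` (i.e. on the category `Var_k`, reducedness being irrelevant), is
invariant under isomorphisms over `k`, satisfies the scissor relations
`[X] = [X ∖ Z] + [Z]` for closed subschemes `Z ⊆ X`, is multiplicative on fibre products
over `k`, and sends `Spec k` to `1`.  These are exactly the defining relations of the
Grothendieck ring of varieties `K₀(Var_k)`, so an identity holds in `K₀(Var_k)` if and
only if it holds for every motivic measure. -/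
structure MotivicMeasure (k : Type u) [Field k] (R : Type v) [CommRing R] where
  cl : ∀ (X : Scheme.{u}), (X ⟶ SpecBase k) → R
  cl_point : cl (SpecBase k) (𝟙 (SpecBase k)) = 1
  cl_iso : ∀ {X Y : Scheme.{u}} (sX : X ⟶ SpecBase k) (sY : Y ⟶ SpecBase k) (e : X ≅ Y),
    LocallyOfFiniteType sX → QuasiCompact sX → IsSeparated sX →
    e.hom ≫ sY = sX → cl X sX = cl Y sY
  cl_scissor : ∀ {X Z : Scheme.{u}} (sX : X ⟶ SpecBase k) (i : Z ⟶ X),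
    LocallyOfFiniteType sX → QuasiCompact sX → IsSeparated sX →
    IsClosedImmersion i → ∀ U : X.Opens, (U : Set X) = (Set.range i.base)ᶜ →
    cl X sX = cl U.toScheme (U.ι ≫ sX) + cl Z (i ≫ sX)
  cl_prod : ∀ {X Y : Scheme.{u}} (sX : X ⟶ SpecBase k) (sY : Y ⟶ SpecBase k),
    LocallyOfFiniteType sX → QuasiCompact sX → IsSeparated sX →
    LocallyOfFiniteType sY → QuasiCompact sY → IsSeparated sY →
    cl (pullback sX sY) (pullback.fst sX sY ≫ sX) = cl X sX * cl Y sY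

/-- The class of the affine line, `𝕃 = [𝔸¹_k]`, under a motivic measure. -/
def MotivicMeasure.lef {k : Type u} [Field k] {R : Type v} [CommRing R]
    (μ : MotivicMeasure k R) : R :=
  μ.cl (AffineLine k) (AffineLine.toSpec k)

/-- `X` and `Y` are birational over `k`: they contain isomorphic dense open subschemes. -/
def BirationalOver (k : Type u) [Field k] (X Y : Scheme.{u})
    (sX : X ⟶ SpecBase k) (sY : Y ⟶ SpecBase k) : Prop :=
  ∃ (U : X.Opens) (V : Y.Opens) (e : U.toScheme ≅ V.toScheme),
    Dense (U : Set X) ∧ Dense (V : Set Y) ∧ e.hom ≫ V.ι ≫ sY = U.ι ≫ sX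

end

namespace MotivicMeasure

section Basic

variable {k : Type u} [Field k] {R : Type v} [CommRing R] (μ : MotivicMeasure k R)

lemma cl_of_isEmpty {X : Scheme.{u}} (sX : X ⟶ SpecBase k) [IsEmpty X] : μ.cl X sX = 0 := by
  have h := μ.cl_scissor sX (𝟙 X) inferInstance inferInstance inferInstance inferInstance ⊤
    (by ext x; exact isEmptyElim x)
  have e := μ.cl_iso ((⊤ : X.Opens).ι ≫ sX) sX X.topIso inferInstance inferInstance inferInstance
    (by simp)
  rw [e] at h
  simpa using h

lemma cl_eq_of_surjective {X Z : Scheme.{u}} (sX : X ⟶ SpecBase k) (i : Z ⟶ X)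
    [LocallyOfFiniteType sX] [QuasiCompact sX] [IsSeparated sX] [IsClosedImmersion i]
    [Surjective i] : μ.cl Z (i ≫ sX) = μ.cl X sX := by
  have h := μ.cl_scissor sX i inferInstance inferInstance inferInstance inferInstance ⊥
    (by rw [Set.range_eq_univ.mpr i.surjective]; simp)
  have : IsEmpty (⊥ : X.Opens).toScheme := ⟨fun x ↦ x.2⟩
  rw [h, μ.cl_of_isEmpty ((⊥ : X.Opens).ι ≫ sX), zero_add]

lemma cl_eq_of_range_eq {V W W' : Scheme.{u}} (sV : V ⟶ SpecBase k) (i : W ⟶ V) (i' : W' ⟶ V)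
    [IsPreimmersion i] [IsPreimmersion i'] (h : Set.range i = Set.range i')
    [LocallyOfFiniteType (i ≫ sV)] [QuasiCompact (i ≫ sV)] [IsSeparated (i ≫ sV)]
    [LocallyOfFiniteType (i' ≫ sV)] [QuasiCompact (i' ≫ sV)] [IsSeparated (i' ≫ sV)] :
    μ.cl W (i ≫ sV) = μ.cl W' (i' ≫ sV) := by
  have h₁ : Set.range (pullback.fst i i') = Set.univ := by
    rw [Scheme.Pullback.range_fst, ← h, Set.preimage_range]
  have h₂ : Set.range (pullback.snd i i') = Set.univ := by
    rw [Scheme.Pullback.range_snd, h, Set.preimage_range]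
  have : Surjective (pullback.fst i i') := ⟨Set.range_eq_univ.mp h₁⟩
  have : Surjective (pullback.snd i i') := ⟨Set.range_eq_univ.mp h₂⟩
  have : IsClosedImmersion (pullback.fst i i') :=
    .of_isPreimmersion _ (by rw [h₁]; exact isClosed_univ)
  have : IsClosedImmersion (pullback.snd i i') :=
    .of_isPreimmersion _ (by rw [h₂]; exact isClosed_univ)
  rw [← μ.cl_eq_of_surjective (i ≫ sV) (pullback.fst i i'),
    ← μ.cl_eq_of_surjective (i' ≫ sV) (pullback.snd i i'), pullback.condition_assoc]

/-- The class of a subscheme filtered by closed subsets is the sum of the classes of its strata. -/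
lemma cl_eq_sum_strata {P : Scheme.{u}} (sP : P ⟶ SpecBase k) (N : ℕ) :
    ∀ (F : ℕ → Set P) (_ : ∀ i, IsClosed (F i)) (_ : ∀ i, F (i + 1) ⊆ F i) (_ : F N = ∅)
      (c : ℕ → R) (_ : ∀ i < N, ∃ (W : Scheme.{u}) (w : W ⟶ P), IsPreimmersion w ∧
        Set.range w = F i \ F (i + 1) ∧ LocallyOfFiniteType (w ≫ sP) ∧ QuasiCompact (w ≫ sP) ∧
        IsSeparated (w ≫ sP) ∧ μ.cl W (w ≫ sP) = c i)
      (X : Scheme.{u}) (j : X ⟶ P) (_ : IsPreimmersion j) (_ : Set.range j = F 0)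
      (_ : LocallyOfFiniteType (j ≫ sP)) (_ : QuasiCompact (j ≫ sP)) (_ : IsSeparated (j ≫ sP)),
      μ.cl X (j ≫ sP) = ∑ i ∈ Finset.range N, c i := by
  induction N with
  | zero =>
    intro F _ _ hF c _ X j _ hj _ _ _
    have : IsEmpty X := Set.range_eq_empty_iff.mp (hj.trans hF)
    simp [cl_of_isEmpty]
  | succ N ih =>
    intro F hc hs hF c hw X j _ hj _ _ _
    obtain ⟨W, w, _, hr, _, _, _, hcl⟩ := hw 0 N.succ_pos
    let C : TopologicalSpace.Closeds X := ⟨j ⁻¹' F 1, (hc 1).preimage j.continuous⟩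
    let I := Scheme.IdealSheafData.vanishingIdeal C
    have hI : Set.range I.subschemeι = j ⁻¹' F 1 := by
      rw [Scheme.IdealSheafData.range_subschemeι, Scheme.IdealSheafData.coe_support_vanishingIdeal]
      rfl
    let U : X.Opens := ⟨(j ⁻¹' F 1)ᶜ, ((hc 1).preimage j.continuous).isOpen_compl⟩
    have hU : Set.range (U.ι ≫ j) = Set.range w := by
      rw [hr, Scheme.Hom.comp_base, TopCat.coe_comp, Set.range_comp,
        Scheme.Opens.range_ι, ← hj]
      ext x
      constructor
      · rintro ⟨y, hy, rfl⟩
        exact ⟨⟨y, rfl⟩, hy⟩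
      · rintro ⟨⟨y, rfl⟩, hy⟩
        exact ⟨y, hy, rfl⟩
    have hZ : Set.range (I.subschemeι ≫ j) = F 1 := by
      rw [Scheme.Hom.comp_base, TopCat.coe_comp, Set.range_comp, hI,
        Set.image_preimage_eq_inter_range, hj, Set.inter_eq_left]
      exact hs 0
    rw [μ.cl_scissor (j ≫ sP) I.subschemeι inferInstance inferInstance inferInstance inferInstance U
      (by rw [hI]; rfl), Finset.sum_range_succ', add_comm, ← Category.assoc, ← Category.assoc]
    have : QuasiCompact ((U.ι ≫ j) ≫ sP) := by
      have : IsLocallyNoetherian X := LocallyOfFiniteType.isLocallyNoetherian (j ≫ sP)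
      rw [Category.assoc]
      infer_instance
    have : LocallyOfFiniteType ((U.ι ≫ j) ≫ sP) := by
      rw [Category.assoc]
      infer_instance
    have : IsSeparated ((U.ι ≫ j) ≫ sP) := by
      rw [Category.assoc]
      infer_instance
    congr 1
    · refine ih (fun i ↦ F (i + 1)) (fun i ↦ hc _) (fun i ↦ hs _) hF (fun i ↦ c (i + 1))
        (fun i hi ↦ hw _ (by omega)) _ (I.subschemeι ≫ j) inferInstance hZ ?_ ?_ ?_ <;>
      · rw [Category.assoc]
        infer_instance
    · exact (μ.cl_eq_of_range_eq sP (U.ι ≫ j) w hU).trans hcl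

end Basic

section Affine

open scoped TensorProduct

variable {k : Type u} [Field k] {R : Type v} [CommRing R] (μ : MotivicMeasure k R)

/-- The structure morphism of the spectrum of a `k`-algebra. -/
noncomputable abbrev structSpec (k : Type u) [Field k] (A : Type u) [CommRing A] [Algebra k A] :
    Spec (CommRingCat.of A) ⟶ SpecBase k :=
  Spec.map (CommRingCat.ofHom (algebraMap k A))

/-- The class of the spectrum of a `k`-algebra. -/
noncomputable def clSpec (A : Type u) [CommRing A] [Algebra k A] : R :=
  μ.cl (Spec (CommRingCat.of A)) (structSpec k A)

instance locallyOfFiniteType_structSpec (A : Type u) [CommRing A] [Algebra k A]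
    [Algebra.FiniteType k A] : LocallyOfFiniteType (structSpec k A) := by
  rw [HasRingHomProperty.Spec_iff (P := @LocallyOfFiniteType)]
  exact (RingHom.finiteType_algebraMap (A := k) (B := A)).mpr inferInstance

variable {A B : Type u} [CommRing A] [Algebra k A] [CommRing B] [Algebra k B]

lemma clSpec_congr [Algebra.FiniteType k A] (e : A ≃ₐ[k] B) : μ.clSpec A = μ.clSpec B := by
  refine μ.cl_iso _ _ (Scheme.Spec.mapIso e.toRingEquiv.toCommRingCatIso.op).symm
    inferInstance inferInstance inferInstance ?_
  simp only [Iso.symm_hom, Functor.mapIso_inv, Iso.op_inv, Scheme.Spec_map, Quiver.Hom.unop_op,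
    ← Spec.map_comp, RingEquiv.toCommRingCatIso_inv, ← CommRingCat.ofHom_comp]
  congr 2
  ext x
  exact e.symm.commutes x

lemma clSpec_self : μ.clSpec k = 1 := by
  have : structSpec k k = 𝟙 _ := Spec.map_id _
  rw [clSpec, this, μ.cl_point]

lemma clSpec_tensorProduct [Algebra.FiniteType k A] [Algebra.FiniteType k B] :
    μ.clSpec (A ⊗[k] B) = μ.clSpec A * μ.clSpec B := by
  have := Algebra.FiniteType.trans (R := k) (S := A) (A := A ⊗[k] B) inferInstance inferInstance
  rw [clSpec, clSpec, clSpec, ← μ.cl_prod _ _ inferInstance inferInstance inferInstance inferInstance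
    inferInstance inferInstance]
  refine μ.cl_iso _ _ (pullbackSpecIso k A B).symm inferInstance inferInstance inferInstance ?_
  rw [Iso.symm_hom, pullbackSpecIso_inv_fst_assoc, ← Spec.map_comp, ← CommRingCat.ofHom_comp]

lemma clSpec_mvPolynomial_fin (d : ℕ) : μ.clSpec (MvPolynomial (Fin d) k) = μ.lef ^ d := by
  induction d with
  | zero => rw [μ.clSpec_congr (isEmptyAlgEquiv k (Fin 0)), clSpec_self, pow_zero]
  | succ d ih =>
    rw [μ.clSpec_congr (finSuccEquiv k d), μ.clSpec_congr (polyEquivTensor k (MvPolynomial (Fin d) k)),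
      clSpec_tensorProduct, ih, pow_succ]
    rfl

end Affine

end MotivicMeasure

section QuotientTensor

open scoped TensorProduct

variable {k : Type*} [Field k] {m d : ℕ}

/-- The algebra map out of a quotient by the ideal spanned by `S`. -/
noncomputable def spanLift {A B : Type*} [CommRing A] [Algebra k A] [Semiring B] [Algebra k B]
    (S : Set A) (f : A →ₐ[k] B) (hf : ∀ s ∈ S, f s = 0) : A ⧸ Ideal.span S →ₐ[k] B :=
  Ideal.Quotient.liftₐ _ f fun _ ha ↦ (Ideal.span_le (I := RingHom.ker f)).mpr hf ha

@[simp]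
lemma spanLift_mk {A B : Type*} [CommRing A] [Algebra k A] [Semiring B] [Algebra k B]
    (S : Set A) (f : A →ₐ[k] B) (hf : ∀ s ∈ S, f s = 0) (a : A) :
    spanLift S f hf (Ideal.Quotient.mk _ a) = f a :=
  rfl

/-- The map adding `d` free variables to the quotient of a polynomial ring. -/
noncomputable def quotientTensorHom (S : Set (MvPolynomial (Fin m) k)) :
    (MvPolynomial (Fin m) k ⧸ Ideal.span S) ⊗[k] MvPolynomial (Fin d) k →ₐ[k]
      MvPolynomial (Fin (m + d)) k ⧸ Ideal.span (rename (Fin.castAdd d) '' S) :=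
  Algebra.TensorProduct.productMap
    (spanLift S ((Ideal.Quotient.mkₐ k _).comp (rename (Fin.castAdd d)))
      (by
        intro s hs
        rw [AlgHom.comp_apply, Ideal.Quotient.mkₐ_eq_mk, Ideal.Quotient.eq_zero_iff_mem]
        exact Ideal.subset_span ⟨s, hs, rfl⟩))
    ((Ideal.Quotient.mkₐ k _).comp (rename (Fin.natAdd m)))

/-- The map splitting off the last `d` variables of a polynomial ring in `m + d` variables. -/
noncomputable def splitVars (d : ℕ) (S : Set (MvPolynomial (Fin m) k)) :
    MvPolynomial (Fin (m + d)) k →ₐ[k]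
      (MvPolynomial (Fin m) k ⧸ Ideal.span S) ⊗[k] MvPolynomial (Fin d) k :=
  aeval (Fin.addCases (motive := fun _ ↦ (MvPolynomial (Fin m) k ⧸ Ideal.span S) ⊗[k]
    MvPolynomial (Fin d) k) (fun i ↦ Ideal.Quotient.mk _ (X i) ⊗ₜ 1) (fun i ↦ 1 ⊗ₜ X i))

lemma splitVars_rename (S : Set (MvPolynomial (Fin m) k)) (p : MvPolynomial (Fin m) k) :
    splitVars d S (rename (Fin.castAdd d) p) = Ideal.Quotient.mk (Ideal.span S) p ⊗ₜ 1 := by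
  have h : (splitVars d S).comp (rename (Fin.castAdd d)) =
      Algebra.TensorProduct.includeLeft.comp (Ideal.Quotient.mkₐ k (Ideal.span S)) := by
    ext i
    simp [splitVars]
  exact DFunLike.congr_fun h p

/-- Adding `d` free variables to the quotient of a polynomial ring. -/
noncomputable def quotientTensorEquiv (S : Set (MvPolynomial (Fin m) k)) :
    (MvPolynomial (Fin m) k ⧸ Ideal.span S) ⊗[k] MvPolynomial (Fin d) k ≃ₐ[k]
      MvPolynomial (Fin (m + d)) k ⧸ Ideal.span (rename (Fin.castAdd d) '' S) :=
  AlgEquiv.ofAlgHom (quotientTensorHom S)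
    (spanLift _ (splitVars d S) (by
      rintro _ ⟨s, hs, rfl⟩
      rw [splitVars_rename, Ideal.Quotient.eq_zero_iff_mem.mpr (Ideal.subset_span hs),
        TensorProduct.zero_tmul]))
    (by
      apply Ideal.Quotient.algHom_ext
      ext i
      refine Fin.addCases (fun i ↦ ?_) (fun i ↦ ?_) i
      · simp [splitVars, quotientTensorHom]
      · simp [splitVars, quotientTensorHom])
    (by
      apply Algebra.TensorProduct.ext
      · apply Ideal.Quotient.algHom_ext
        ext i
        simp [splitVars, quotientTensorHom]
      · ext i
        simp [splitVars, quotientTensorHom])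

end QuotientTensor

/-- Adding free variables multiplies the class of an affine scheme by a power of `𝕃`. -/
lemma MotivicMeasure.clSpec_quotient_rename {k : Type u} [Field k] {R : Type v} [CommRing R]
    (μ : MotivicMeasure k R) {m n : ℕ} (h : m ≤ n) (S : Set (MvPolynomial (Fin m) k)) :
    μ.clSpec (MvPolynomial (Fin n) k ⧸ Ideal.span (rename (Fin.castLE h) '' S)) =
      μ.lef ^ (n - m) * μ.clSpec (MvPolynomial (Fin m) k ⧸ Ideal.span S) := by
  obtain ⟨d, rfl⟩ := Nat.exists_eq_add_of_le h
  rw [Nat.add_sub_cancel_left, mul_comm, ← μ.clSpec_mvPolynomial_fin, ← μ.clSpec_tensorProduct]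
  exact μ.clSpec_congr (quotientTensorEquiv S).symm

section Chart

open HomogeneousLocalization

attribute [local instance] MvPolynomial.gradedAlgebra

variable {k : Type u} [Field k] {n : ℕ} (i : Fin (n + 1)) (S : Set (MvPolynomial (Fin (n + 1)) k))

lemma X_mem_homogeneousSubmodule (j : Fin (n + 1)) :
    (X j : MvPolynomial (Fin (n + 1)) k) ∈ homogeneousSubmodule (Fin (n + 1)) k 1 :=
  isHomogeneous_X k j

lemma X_mem_homogeneousSubmodule_smul (j : Fin (n + 1)) :
    (X j : MvPolynomial (Fin (n + 1)) k) ∈ homogeneousSubmodule (Fin (n + 1)) k (1 • 1) :=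
  isHomogeneous_X k j

lemma C_mem_homogeneousSubmodule_smul (r : k) :
    (C r : MvPolynomial (Fin (n + 1)) k) ∈ homogeneousSubmodule (Fin (n + 1)) k (0 • 1) :=
  isHomogeneous_C _ r

lemma aeval_const_mul_of_isHomogeneous {σ K L : Type*} [CommRing K] [CommRing L]
    [Algebra K L] {p : MvPolynomial σ K} {d : ℕ} (hp : p.IsHomogeneous d) (c : L) (f : σ → L) :
    aeval (fun j ↦ c * f j) p = c ^ d * aeval f p := by
  simp only [aeval_def, eval₂_eq, Finset.mul_sum]
  refine Finset.sum_congr rfl fun e he ↦ ?_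
  have hd : ∑ j ∈ e.support, e j = d := by
    have := hp (mem_support_iff.mp he)
    rwa [Finsupp.weight_apply, Finsupp.sum, Finset.sum_congr rfl (g := fun j ↦ e j)
      (fun j _ ↦ by simp)] at this
  simp only [mul_pow, Finset.prod_mul_distrib, Finset.prod_pow_eq_pow_sum, hd]
  ring

/-- Restriction of functions from the standard chart `xᵢ ≠ 0` to the locus cut out by `S` and
`xᵢ = 1`. -/
noncomputable def chartHom :
    Away (homogeneousSubmodule (Fin (n + 1)) k) (X i) →+*
      MvPolynomial (Fin (n + 1)) k ⧸ Ideal.span (insert (X i - 1) S) :=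
  (IsLocalization.Away.lift (S := Localization.Away (X i : MvPolynomial (Fin (n + 1)) k)) (X i)
    (g := Ideal.Quotient.mk (Ideal.span (insert (X i - 1) S))) (by
      have : Ideal.Quotient.mk (Ideal.span (insert (X i - 1) S)) (X i) = 1 :=
        (Ideal.Quotient.mk_eq_mk_iff_sub_mem _ _).mpr (Ideal.subset_span (Set.mem_insert _ _))
      rw [this]
      exact isUnit_one)).comp (algebraMap _ _)

lemma chartHom_mk (m : ℕ) (x : MvPolynomial (Fin (n + 1)) k)
    (hx : x ∈ homogeneousSubmodule (Fin (n + 1)) k (m • 1)) :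
    chartHom i S (Away.mk _ (X_mem_homogeneousSubmodule i) m x hx) = Ideal.Quotient.mk _ x := by
  have h1 : Ideal.Quotient.mk (Ideal.span (insert (X i - 1) S)) (X i) = 1 :=
    (Ideal.Quotient.mk_eq_mk_iff_sub_mem _ _).mpr (Ideal.subset_span (Set.mem_insert _ _))
  rw [chartHom, RingHom.comp_apply, HomogeneousLocalization.algebraMap_apply, Away.val_mk,
    Localization.mk_eq_mk', IsLocalization.Away.lift, IsLocalization.lift_mk'_spec]
  simp [h1]

/-- Dehomogenization with respect to `xᵢ`. -/
noncomputable def dehomog :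
    MvPolynomial (Fin (n + 1)) k →+* Away (homogeneousSubmodule (Fin (n + 1)) k) (X i) :=
  eval₂Hom ((fromZeroRingHom _ _).comp (algebraMap k (homogeneousSubmodule (Fin (n + 1)) k 0)))
    fun j ↦ Away.mk _ (X_mem_homogeneousSubmodule i) 1 (X j) (X_mem_homogeneousSubmodule_smul j)

lemma dehomog_of_isHomogeneous {d : ℕ} {x : MvPolynomial (Fin (n + 1)) k}
    (hx : x ∈ homogeneousSubmodule (Fin (n + 1)) k (d • 1)) :
    dehomog i x = Away.mk _ (X_mem_homogeneousSubmodule i) d x hx := by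
  have hx' : x.IsHomogeneous d := by simpa using hx
  let L := Localization.Away (X i : MvPolynomial (Fin (n + 1)) k)
  let c : L := IsLocalization.Away.invSelf (X i : MvPolynomial (Fin (n + 1)) k)
  have hmk (m : ℕ) (y : MvPolynomial (Fin (n + 1)) k) (h : X i ^ m ∈ Submonoid.powers (X i)) :
      Localization.mk y ⟨X i ^ m, h⟩ = c ^ m * algebraMap _ L y := by
    rw [Localization.mk_eq_mk', IsLocalization.mk'_eq_iff_eq_mul, mul_right_comm, map_pow,
      ← mul_pow, mul_comm c, IsLocalization.Away.mul_invSelf, one_pow, one_mul]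
  have key : (algebraMap _ L).comp (dehomog i) =
      (aeval (R := k) (fun j ↦ c * algebraMap (MvPolynomial (Fin (n + 1)) k) L (X j))).toRingHom := by
    apply MvPolynomial.ringHom_ext
    · intro r
      refine (congrArg HomogeneousLocalization.val (eval₂Hom_C _ _ r)).trans ?_
      refine (Localization.mk_one_eq_algebraMap (C r)).trans ?_
      rw [AlgHom.toRingHom_eq_coe, RingHom.coe_coe, aeval_C]
      exact (IsScalarTower.algebraMap_apply k (MvPolynomial (Fin (n + 1)) k) L r).symm
    · intro j
      refine (congrArg HomogeneousLocalization.val (eval₂Hom_X' _ _ j)).trans ?_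
      refine (Away.val_mk ..).trans ?_
      rw [hmk, AlgHom.toRingHom_eq_coe, RingHom.coe_coe, aeval_X, pow_one]
  apply HomogeneousLocalization.val_injective
  refine (RingHom.congr_fun key x).trans ?_
  rw [AlgHom.toRingHom_eq_coe, RingHom.coe_coe, aeval_const_mul_of_isHomogeneous hx', Away.val_mk, hmk]
  have h : aeval (R := k) (fun j ↦ algebraMap (MvPolynomial (Fin (n + 1)) k) L (X j)) x =
      algebraMap _ L x := by
    have := (aeval_unique (IsScalarTower.toAlgHom k (MvPolynomial (Fin (n + 1)) k) L))
    exact (DFunLike.congr_fun this x).symm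
  rw [h]

lemma chartHom_comp_dehomog : (chartHom i S).comp (dehomog i) = Ideal.Quotient.mk _ := by
  apply MvPolynomial.ringHom_ext
  · intro r
    rw [RingHom.comp_apply, dehomog_of_isHomogeneous i (d := 0) (C_mem_homogeneousSubmodule_smul _), chartHom_mk]
  · intro j
    rw [RingHom.comp_apply, dehomog_of_isHomogeneous i (d := 1) (X_mem_homogeneousSubmodule_smul _), chartHom_mk]

lemma chartHom_surjective : Function.Surjective (chartHom i S) := by
  intro b
  obtain ⟨x, rfl⟩ := Ideal.Quotient.mk_surjective b
  exact ⟨dehomog i x, RingHom.congr_fun (chartHom_comp_dehomog i S) x⟩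

lemma ker_chartHom_le_iff (p : Ideal (Away (homogeneousSubmodule (Fin (n + 1)) k) (X i))) :
    RingHom.ker (chartHom i S) ≤ p ↔ ∀ s ∈ S, dehomog i s ∈ p := by
  constructor
  · intro h s hs
    apply h
    rw [RingHom.mem_ker, ← RingHom.comp_apply, chartHom_comp_dehomog,
      Ideal.Quotient.eq_zero_iff_mem]
    exact Ideal.subset_span (Set.mem_insert_of_mem _ hs)
  · intro h a ha
    obtain ⟨m, x, hx, rfl⟩ := Away.mk_surjective _ (X_mem_homogeneousSubmodule i) a
    rw [RingHom.mem_ker, chartHom_mk, Ideal.Quotient.eq_zero_iff_mem] at ha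
    rw [← dehomog_of_isHomogeneous]
    refine (Ideal.span_le (I := p.comap (dehomog i))).mpr ?_ ha
    intro s hs
    obtain rfl | hs := hs
    · rw [SetLike.mem_coe, Ideal.mem_comap, map_sub, map_one,
        dehomog_of_isHomogeneous i (d := 1) (X_mem_homogeneousSubmodule_smul _)]
      convert p.zero_mem
      rw [sub_eq_zero]
      apply HomogeneousLocalization.val_injective
      simp
    · exact h s hs

/-- The inclusion into projective space of the locus cut out by `S` in the standard
chart `xᵢ ≠ 0`. -/
noncomputable def chartι :
    Spec (CommRingCat.of (MvPolynomial (Fin (n + 1)) k ⧸ Ideal.span (insert (X i - 1) S))) ⟶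
      Proj (homogeneousSubmodule (Fin (n + 1)) k) :=
  Spec.map (CommRingCat.ofHom (chartHom i S)) ≫
    Proj.awayι (homogeneousSubmodule (Fin (n + 1)) k) (X i) (X_mem_homogeneousSubmodule i) Nat.one_pos

instance : IsPreimmersion (chartι i S) := by
  have := IsClosedImmersion.spec_of_surjective (CommRingCat.ofHom (chartHom i S))
    (chartHom_surjective i S)
  rw [chartι]
  exact IsPreimmersion.comp _ _

lemma chartι_toSpec : chartι i S ≫ Proj.toSpecZero _ ≫ Spec.map (CommRingCat.ofHom (algebraMap k _)) = MotivicMeasure.structSpec k _ := by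
  rw [chartι, Category.assoc, Proj.awayι_toSpecZero_assoc, ← Spec.map_comp,
    ← Spec.map_comp, ← CommRingCat.ofHom_comp, ← CommRingCat.ofHom_comp]
  congr 2
  ext r
  have : fromZeroRingHom _ _ (algebraMap k (homogeneousSubmodule (Fin (n + 1)) k 0) r) =
      Away.mk _ (X_mem_homogeneousSubmodule i) 0 (C r) (C_mem_homogeneousSubmodule_smul r) := by
    apply HomogeneousLocalization.val_injective
    rw [Away.val_mk]
    rfl
  refine (congrArg (chartHom i S) this).trans ?_
  rw [chartHom_mk]
  rfl

/-- The zero locus of a set of polynomials, as a subset of the scheme `Proj k[x₀, …, xₙ]`. -/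
def projZeroLocus (S : Set (MvPolynomial (Fin (n + 1)) k)) :
    Set (Proj (homogeneousSubmodule (Fin (n + 1)) k)) :=
  ProjectiveSpectrum.zeroLocus (homogeneousSubmodule (Fin (n + 1)) k) S

lemma range_chartι (hS : ∀ s ∈ S, ∃ d, 0 < d ∧ s ∈ homogeneousSubmodule (Fin (n + 1)) k d) :
    Set.range (chartι i S) =
      projZeroLocus S \
        projZeroLocus {X i} := by
  have h1 : Set.range (Spec.map (CommRingCat.ofHom (chartHom i S))) =
      Proj.awayι (homogeneousSubmodule (Fin (n + 1)) k) (X i) (X_mem_homogeneousSubmodule i) Nat.one_pos ⁻¹'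
        projZeroLocus S := by
    have : Set.range (Spec.map (CommRingCat.ofHom (chartHom i S))) =
      PrimeSpectrum.zeroLocus (RingHom.ker (chartHom i S)) :=
      range_comap_of_surjective _ _ (chartHom_surjective i S)
    rw [this]
    ext p
    rw [PrimeSpectrum.mem_zeroLocus, SetLike.coe_subset_coe, ker_chartHom_le_iff]
    refine forall₂_congr fun s hs ↦ ?_
    obtain ⟨d, hd, hsd⟩ := hS s hs
    have h := congrArg (p ∈ ·) (Proj.awayι_preimage_basicOpen
      (homogeneousSubmodule (Fin (n + 1)) k) (X_mem_homogeneousSubmodule i) Nat.one_pos hsd hd)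
    have h2 : Away.isLocalizationElem (X_mem_homogeneousSubmodule i) hsd = dehomog i s := by
      rw [dehomog_of_isHomogeneous i (d := d) (by simpa using hsd)]
      apply HomogeneousLocalization.val_injective
      simp
    rw [h2] at h
    exact (not_iff_not.mp (iff_of_eq h)).symm
  have h2 : Set.range (Proj.awayι (homogeneousSubmodule (Fin (n + 1)) k) (X i)
      (X_mem_homogeneousSubmodule i) Nat.one_pos) =
        (projZeroLocus {X i})ᶜ := by
    refine (congrArg SetLike.coe (Proj.opensRange_awayι (homogeneousSubmodule (Fin (n + 1)) k) (X i)
      (X_mem_homogeneousSubmodule i) Nat.one_pos)).trans ?_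
    exact ProjectiveSpectrum.basicOpen_eq_zeroLocus_compl _ _
  rw [chartι, Scheme.Hom.comp_base, TopCat.coe_comp, Set.range_comp, h1,
    Set.image_preimage_eq_inter_range, h2]
  rfl

end Chart

section Projective

attribute [local instance] MvPolynomial.gradedAlgebra

variable {k : Type u} [Field k] {R : Type v} [CommRing R] (μ : MotivicMeasure k R) {n : ℕ}

lemma algebraMap_homogeneousSubmodule_zero_surjective :
    Function.Surjective (algebraMap k (homogeneousSubmodule (Fin (n + 1)) k 0)) := by
  rintro ⟨x, hx⟩
  refine ⟨coeff 0 x, Subtype.ext ?_⟩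
  exact ((totalDegree_eq_zero_iff_eq_C (p := x)).mp
    ((totalDegree_zero_iff_isHomogeneous _).mpr hx)).symm

instance : Algebra.FiniteType (homogeneousSubmodule (Fin (n + 1)) k 0)
    (MvPolynomial (Fin (n + 1)) k) :=
  have : IsScalarTower k (homogeneousSubmodule (Fin (n + 1)) k 0) (MvPolynomial (Fin (n + 1)) k) :=
    ⟨fun a b c ↦ smul_mul_assoc a (b : MvPolynomial (Fin (n + 1)) k) c⟩
  Algebra.FiniteType.of_restrictScalars_finiteType k _ _

instance : IsClosedImmersion (Spec.map (CommRingCat.ofHom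
    (algebraMap k (homogeneousSubmodule (Fin (n + 1)) k 0)))) :=
  IsClosedImmersion.spec_of_surjective _ algebraMap_homogeneousSubmodule_zero_surjective

instance : LocallyOfFiniteType (ProjSpace.toSpec k n) :=
  inferInstanceAs (LocallyOfFiniteType (Proj.toSpecZero (homogeneousSubmodule (Fin (n + 1)) k) ≫
    Spec.map (CommRingCat.ofHom (algebraMap k _))))

instance : QuasiCompact (ProjSpace.toSpec k n) :=
  inferInstanceAs (QuasiCompact (Proj.toSpecZero (homogeneousSubmodule (Fin (n + 1)) k) ≫
    Spec.map (CommRingCat.ofHom (algebraMap k _))))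

instance : IsSeparated (ProjSpace.toSpec k n) :=
  inferInstanceAs (IsSeparated (Proj.toSpecZero (homogeneousSubmodule (Fin (n + 1)) k) ≫
    Spec.map (CommRingCat.ofHom (algebraMap k _))))

/-- The morphism `chartι`, with values in `ℙⁿ`. -/
noncomputable def chartToProjSpace (i : Fin (n + 1)) (S : Set (MvPolynomial (Fin (n + 1)) k)) :
    Spec (CommRingCat.of (MvPolynomial (Fin (n + 1)) k ⧸ Ideal.span (insert (X i - 1) S))) ⟶
      ProjSpace k n :=
  chartι i S

instance (i : Fin (n + 1)) (S : Set (MvPolynomial (Fin (n + 1)) k)) :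
    IsPreimmersion (chartToProjSpace i S) :=
  inferInstanceAs (IsPreimmersion (chartι i S))

lemma chartToProjSpace_toSpec (i : Fin (n + 1)) (S : Set (MvPolynomial (Fin (n + 1)) k)) :
    chartToProjSpace i S ≫ ProjSpace.toSpec k n = MotivicMeasure.structSpec k _ :=
  chartι_toSpec i S

/-- Equations for the part of `V(f)` on which `xⱼ = 0` for all `j < i`. -/
def flagSet (f : MvPolynomial (Fin (n + 1)) k) (i : ℕ) : Set (MvPolynomial (Fin (n + 1)) k) :=
  insert f (X '' {j | (j : ℕ) < i})

lemma isClosed_projZeroLocus (S : Set (MvPolynomial (Fin (n + 1)) k)) :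
    IsClosed (projZeroLocus S) :=
  ProjectiveSpectrum.isClosed_zeroLocus _ S

lemma projZeroLocus_flagSet_succ (f : MvPolynomial (Fin (n + 1)) k) (i : Fin (n + 1)) :
    projZeroLocus (flagSet f (i + 1)) = projZeroLocus (flagSet f i) ∩ projZeroLocus {X i} := by
  have : flagSet f (i + 1) = flagSet f i ∪ {X i} := by
    have : {j : Fin (n + 1) | (j : ℕ) < i + 1} = {j : Fin (n + 1) | (j : ℕ) < i} ∪ {i} := by
      ext j
      simp only [Set.mem_ofPred_eq, Set.mem_union, Set.mem_singleton_iff, Fin.ext_iff]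
      omega
    rw [flagSet, flagSet, this, Set.image_union, Set.image_singleton, Set.insert_union]
  rw [this]
  exact ProjectiveSpectrum.zeroLocus_union _ _ _

lemma projZeroLocus_flagSet_eq_empty (f : MvPolynomial (Fin (n + 1)) k) :
    projZeroLocus (flagSet f (n + 1)) = ∅ := by
  refine Set.eq_empty_of_forall_notMem fun (x : ProjectiveSpectrum _) hx ↦ ?_
  have hX (j : Fin (n + 1)) : X j ∈ x.asHomogeneousIdeal :=
    hx (Set.mem_insert_of_mem _ ⟨j, j.2, rfl⟩)
  have hp (p : MvPolynomial (Fin (n + 1)) k) (d : ℕ) (hd : 0 < d)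
      (hp : p ∈ homogeneousSubmodule (Fin (n + 1)) k d) : p ∈ Ideal.span (X '' Set.univ) := by
    rw [mem_ideal_span_X_image]
    intro m hm
    by_contra! hm0
    have : m = 0 := Finsupp.ext fun j ↦ hm0 j (Set.mem_univ j)
    have h := hp (mem_support_iff.mp hm)
    rw [this, map_zero] at h
    omega
  refine x.not_irrelevant_le ((HomogeneousIdeal.toIdeal_irrelevant_le _).mpr fun d hd p hpd ↦ ?_)
  refine (Ideal.span_le (I := x.asHomogeneousIdeal.toIdeal)).mpr ?_ (hp p d hd hpd)
  rintro _ ⟨j, -, rfl⟩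
  exact hX j

/-- The class of a projective hypersurface is the sum of the classes of the loci on which
`xᵢ` is the first nonvanishing coordinate. -/
theorem MotivicMeasure.cl_projSubvariety {d : ℕ} (hd : 0 < d) {f : MvPolynomial (Fin (n + 1)) k}
    (hf : f.IsHomogeneous d) {X : Scheme.{u}} {sX : X ⟶ SpecBase k}
    (hX : IsProjSubvariety k n {f} X sX) :
    μ.cl X sX = ∑ i : Fin (n + 1), μ.clSpec (MvPolynomial (Fin (n + 1)) k ⧸
      Ideal.span (insert (MvPolynomial.X i - 1) (flagSet f i))) := by
  obtain ⟨-, j, _, rfl, hj⟩ := hX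
  let c (i : ℕ) : R := if h : i < n + 1 then μ.clSpec (MvPolynomial (Fin (n + 1)) k ⧸
      Ideal.span (insert (MvPolynomial.X ⟨i, h⟩ - 1) (flagSet f i))) else 0
  have hle (i : ℕ) : projZeroLocus (flagSet f (i + 1)) ⊆ projZeroLocus (flagSet f i) :=
    ProjectiveSpectrum.zeroLocus_anti_mono _ (Set.insert_subset_insert
      (Set.image_mono fun j (hj : (j : ℕ) < i) ↦ hj.trans i.lt_succ_self))
  refine (μ.cl_eq_sum_strata (ProjSpace.toSpec k n) (n + 1) (fun i ↦ projZeroLocus (flagSet f i))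
    (fun i ↦ isClosed_projZeroLocus _) hle (projZeroLocus_flagSet_eq_empty f) c ?_ X j inferInstance
    ?_ inferInstance inferInstance inferInstance).trans ?_
  · intro i hi
    refine ⟨_, chartToProjSpace ⟨i, hi⟩ (flagSet f i), inferInstance, ?_, ?_⟩
    · refine (range_chartι ⟨i, hi⟩ (flagSet f i) ?_).trans ?_
      · rintro s (rfl | ⟨j, -, rfl⟩)
        · exact ⟨d, hd, hf⟩
        · exact ⟨1, Nat.one_pos, X_mem_homogeneousSubmodule j⟩
      · refine Eq.trans ?_ (congrArg (projZeroLocus (flagSet f i) \ ·)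
          (projZeroLocus_flagSet_succ f ⟨i, hi⟩)).symm
        exact Set.sdiff_self_inter.symm
    · rw [chartToProjSpace_toSpec]
      refine ⟨inferInstance, inferInstance, inferInstance, ?_⟩
      simp only [c, dif_pos hi]
      rfl
  · refine hj.trans ?_
    have : flagSet f 0 = {f} := by simp [flagSet]
    rw [this]
    rfl
  · rw [Finset.sum_range]
    exact Finset.sum_congr rfl fun i _ ↦ dif_pos i.2

end Projective

section Quadric

variable {k : Type u} [Field k] {R : Type v} [CommRing R] (μ : MotivicMeasure k R)

lemma rename_image_insert_flagSet {m n : ℕ} (h : m + 1 ≤ n + 1) (f : MvPolynomial (Fin (m + 1)) k)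
    (i : Fin (m + 1)) :
    rename (Fin.castLE h) '' insert (X i - 1) (flagSet f i) =
      insert (X (Fin.castLE h i) - 1) (flagSet (rename (Fin.castLE h) f) i) := by
  have hj : Fin.castLE h '' {j | (j : ℕ) < i} = {j : Fin (n + 1) | (j : ℕ) < i} := by
    ext j
    constructor
    · rintro ⟨j, hj, rfl⟩
      exact hj
    · intro (hj : (j : ℕ) < i)
      exact ⟨⟨j, hj.trans i.2⟩, hj, rfl⟩
  rw [flagSet, flagSet, Set.image_insert_eq, Set.image_insert_eq, map_sub, map_one, rename_X, ← hj,
    Set.image_image, Set.image_image]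
  simp only [rename_X]

lemma MotivicMeasure.clSpec_quotient_flagSet_castLE {m n : ℕ} (h : m + 1 ≤ n + 1)
    (f : MvPolynomial (Fin (m + 1)) k) (i : Fin (m + 1)) :
    μ.clSpec (MvPolynomial (Fin (n + 1)) k ⧸ Ideal.span (insert (MvPolynomial.X (Fin.castLE h i) - 1)
      (flagSet (rename (Fin.castLE h) f) i))) =
    μ.lef ^ (n - m) * μ.clSpec (MvPolynomial (Fin (m + 1)) k ⧸
      Ideal.span (insert (MvPolynomial.X i - 1) (flagSet f i))) := by
  rw [← rename_image_insert_flagSet, clSpec_quotient_rename, Nat.add_sub_add_right]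

lemma MotivicMeasure.clSpec_quotient_flagSet_last {n : ℕ} {f : MvPolynomial (Fin (n + 1)) k}
    (hf : aeval (Pi.single (Fin.last n) (1 : k)) f = 0) :
    μ.clSpec (MvPolynomial (Fin (n + 1)) k ⧸ Ideal.span
      (insert (MvPolynomial.X (Fin.last n) - 1) (flagSet f n))) = 1 := by
  let S := insert (MvPolynomial.X (Fin.last n) - 1) (flagSet f n)
  have hS : ∀ s ∈ S, aeval (Pi.single (Fin.last n) (1 : k)) s = 0 := by
    rintro s (rfl | rfl | ⟨j, hj, rfl⟩)
    · simp
    · exact hf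
    · rw [aeval_X, Pi.single_eq_of_ne (Fin.ne_of_lt hj)]
  have h (j : Fin (n + 1)) : Ideal.Quotient.mk (Ideal.span S) (X j) =
      algebraMap k _ (Pi.single (M := fun _ ↦ k) (Fin.last n) 1 j) := by
    obtain rfl | hj := eq_or_ne j (Fin.last n)
    · rw [Pi.single_eq_same, map_one, ← map_one (Ideal.Quotient.mk _), Ideal.Quotient.mk_eq_mk_iff_sub_mem]
      exact Ideal.subset_span (Set.mem_insert _ _)
    · rw [Pi.single_eq_of_ne hj, map_zero, Ideal.Quotient.eq_zero_iff_mem]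
      exact Ideal.subset_span (.inr (.inr ⟨j, Fin.val_lt_last hj, rfl⟩))
  have e : (MvPolynomial (Fin (n + 1)) k ⧸ Ideal.span S) ≃ₐ[k] k :=
    AlgEquiv.ofAlgHom (spanLift S (aeval (Pi.single (Fin.last n) (1 : k))) hS) (Algebra.ofId k _)
      (Subsingleton.elim _ _) (by
        apply Ideal.Quotient.algHom_ext
        ext j
        simp [h, Algebra.ofId_apply])
  rw [← μ.clSpec_self]
  exact μ.clSpec_congr e

/-- The quadratic form `a₀x₀² + ⋯ + a_r x_r²` in `N` variables. -/
noncomputable def diagonalForm {r N : ℕ} (h : r + 1 ≤ N) (a : Fin (r + 1) → k) :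
    MvPolynomial (Fin N) k :=
  ∑ i : Fin (r + 1), C (a i) * X (Fin.castLE h i) ^ 2

variable {r N M n : ℕ} (a : Fin (r + 1) → k)

lemma rename_diagonalForm (h : r + 1 ≤ N) (h' : N ≤ M) :
    rename (Fin.castLE h') (diagonalForm h a) = diagonalForm (h.trans h') a := by
  simp [diagonalForm]

lemma isHomogeneous_diagonalForm (h : r + 1 ≤ N) : (diagonalForm h a).IsHomogeneous 2 :=
  IsHomogeneous.sum _ _ _ fun i _ ↦ by
    simpa using (isHomogeneous_C _ (a i)).mul ((isHomogeneous_X k (Fin.castLE h i)).pow 2)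

lemma aeval_single_last_diagonalForm (h : r + 1 ≤ n) :
    aeval (Pi.single (Fin.last n) (1 : k)) (diagonalForm (h.trans n.le_succ) a) = 0 := by
  rw [diagonalForm, map_sum]
  refine Finset.sum_eq_zero fun i _ ↦ ?_
  have : Fin.castLE (h.trans n.le_succ) i ≠ Fin.last n :=
    Fin.ne_of_lt (Nat.lt_of_lt_of_le i.2 h)
  simp [Pi.single_eq_of_ne this]

lemma MotivicMeasure.cl_diagonalForm (hrn : r < n) {Q : Scheme.{u}} {sQ : Q ⟶ SpecBase k}
    (hQ : IsProjSubvariety k n {diagonalForm (by omega) a} Q sQ)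
    {Y : Scheme.{u}} {sY : Y ⟶ SpecBase k} (hY : IsProjSubvariety k r {diagonalForm le_rfl a} Y sY) :
    μ.cl Q sQ = (∑ i ∈ Finset.range (n - r), μ.lef ^ i) + μ.lef ^ (n - r) * μ.cl Y sY := by
  obtain ⟨d, rfl⟩ : ∃ d, n = r + d := Nat.exists_eq_add_of_le hrn.le
  have hsum (c : Fin (r + d + 1) → R) : ∑ i, c i =
      ∑ i : Fin (r + 1), c (Fin.castLE (Nat.succ_le_succ (r.le_add_right d)) i) +
        ∑ i : Fin d, c ⟨r + 1 + i, by omega⟩ := by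
    rw [← Fin.sum_congr' c (Nat.add_right_comm r 1 d), Fin.sum_univ_add]
    rfl
  rw [μ.cl_projSubvariety two_pos (isHomogeneous_diagonalForm a _) hQ,
    μ.cl_projSubvariety two_pos (isHomogeneous_diagonalForm a _) hY, Nat.add_sub_cancel_left,
    Finset.mul_sum, hsum,
    add_comm (∑ i ∈ Finset.range d, _)]
  congr 1
  · refine Finset.sum_congr rfl fun i _ ↦ ?_
    have := μ.clSpec_quotient_flagSet_castLE (n := r + d) (by omega) (diagonalForm le_rfl a) i
    rw [rename_diagonalForm, Nat.add_sub_cancel_left] at this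
    exact this
  · rw [← Finset.sum_range_reflect, Finset.sum_range]
    refine Finset.sum_congr rfl fun i _ ↦ ?_
    have := μ.clSpec_quotient_flagSet_castLE (m := r + 1 + i) (n := r + d) (by omega)
      (diagonalForm (by omega) a) (Fin.last _)
    rw [rename_diagonalForm, Fin.val_last,
      μ.clSpec_quotient_flagSet_last (aeval_single_last_diagonalForm a (by omega)), mul_one,
      show r + d - (r + 1 + i) = d - 1 - i by omega] at this
    exact this

end Quadric

/-- Let `k` be a field of characteristic zero and let
`Q = V(q) ⊂ ℙⁿ_k` be a singular (degenerate) quadric, written after diagonalization as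
`q = a₀x₀² + ⋯ + a_r x_r²` with `r < n`, and let `Y := V(a₀x₀² + ⋯ + a_r x_r²) ⊂ ℙ^r_k`.
Then `[Q] = 1 + 𝕃 + ⋯ + 𝕃^{n-r-1} + 𝕃^{n-r}·[Y]` in `K₀(Var_k)`; in particular
`[Q] ≡ 1 mod 𝕃`. -/
theorem singular_quadric_class_formula (k : Type u) [Field k] [CharZero k] (n r : ℕ)
    (hrn : r < n) (a : Fin (r + 1) → k) (ha : a ≠ 0)
    (Q : Scheme.{u}) (sQ : Q ⟶ SpecBase k)
    (hQ : IsProjSubvariety k n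
      {∑ i : Fin (r + 1), C (a i) * (X (Fin.castLE (by omega) i) : MvPolynomial (Fin (n + 1)) k) ^ 2}
      Q sQ)
    (Y : Scheme.{u}) (sY : Y ⟶ SpecBase k)
    (hY : IsProjSubvariety k r
      {∑ i : Fin (r + 1), C (a i) * (X i : MvPolynomial (Fin (r + 1)) k) ^ 2} Y sY) :
    ∀ (R : Type u) [CommRing R] (μ : MotivicMeasure k R),
      (μ.cl Q sQ = (∑ i ∈ Finset.range (n - r), μ.lef ^ i) + μ.lef ^ (n - r) * μ.cl Y sY)
      ∧ μ.cl Q sQ - 1 ∈ Ideal.span {μ.lef} := by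
  intro R _ μ
  have h := μ.cl_diagonalForm a hrn hQ hY
  refine ⟨h, ?_⟩
  obtain ⟨d, hd⟩ : ∃ d, n - r = d + 1 := ⟨n - r - 1, by omega⟩
  rw [h, hd, Finset.sum_range_succ', pow_zero, Ideal.mem_span_singleton, add_right_comm,
    add_sub_cancel_right]
  exact dvd_add (Finset.dvd_sum fun i _ ↦ Dvd.intro_left _ (pow_succ _ i).symm)
    ((Dvd.intro_left _ (pow_succ _ d).symm).mul_right _)
end

section
/- Let X = V(f) ⊂ ℙⁿ_k be a cubic hypersurface over a field k with a singular k-rational point at [0:⋯:0:1], so that f(x₀,…,xₙ) = xₙ²f₁(x₀,…,x_{n−1}) + xₙf₂(x₀,…,x_{n−1}) + f₃(x₀,…,x_{n−1}) with fᵢ homogeneous of degree i. Then f₁ = 0, and [X] = 1 + [ℙ^{n−1}_k ∖ V(f₂)] + 𝕃·[V(f₂,f₃)] in K₀(Var_k), where V(f₂) ⊂ ℙ^{n−1}_k and V(f₂,f₃) ⊂ ℙ^{n−1}_k. -/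
open AlgebraicGeometry CategoryTheory CategoryTheory.Limits MvPolynomial

universe u v

noncomputable section

attribute [local instance] MvPolynomial.gradedAlgebra

end

attribute [local instance] MvPolynomial.gradedAlgebra

noncomputable section

/-- A separated morphism of finite type to `Spec k`: the structure morphism of a variety. -/
structure IsVarietyStr {k : Type u} [Field k] {X : Scheme.{u}} (s : X ⟶ SpecBase k) : Prop where
  lft : LocallyOfFiniteType s
  qc : QuasiCompact s
  sep : IsSeparated s

namespace IsVarietyStr

variable {k : Type u} [Field k] {X Y : Scheme.{u}} {s : X ⟶ SpecBase k}

lemma isNoetherian (h : IsVarietyStr s) : IsNoetherian X := by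
  have := h.lft
  have := h.qc
  have := QuasiCompact.compactSpace_of_compactSpace s
  exact { LocallyOfFiniteType.isLocallyNoetherian s, this with }

lemma openImmersion_comp (h : IsVarietyStr s) (j : Y ⟶ X) [IsOpenImmersion j] :
    IsVarietyStr (j ≫ s) := by
  have := h.lft
  have := h.qc
  have := h.sep
  have := h.isNoetherian
  exact ⟨inferInstance, inferInstance, inferInstance⟩

lemma specMap {A : Type u} [CommRing A] {φ : k →+* A} (h : φ.FiniteType) :
    IsVarietyStr (Spec.map (CommRingCat.ofHom φ)) :=
  ⟨(HasRingHomProperty.Spec_iff (P := @LocallyOfFiniteType)).mpr h, inferInstance, inferInstance⟩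

end IsVarietyStr

namespace MotivicMeasure

variable {k : Type u} [Field k] {R : Type v} [CommRing R] (μ : MotivicMeasure k R)
  {X Y Z : Scheme.{u}} {s : X ⟶ SpecBase k}

/-- The class of an open subscheme. -/
def opn (s : X ⟶ SpecBase k) (V : X.Opens) : R := μ.cl V.toScheme (V.ι ≫ s)

lemma cl_eq_opn_top (h : IsVarietyStr s) : μ.cl X s = μ.opn s ⊤ := by
  have h' := h.openImmersion_comp (⊤ : X.Opens).ι
  exact (μ.cl_iso _ s X.topIso h'.lft h'.qc h'.sep (by simp)).symm

lemma opn_image (h : IsVarietyStr s) (j : Y ⟶ X) [IsOpenImmersion j] (V : Y.Opens) :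
    μ.opn s (j ''ᵁ V) = μ.opn (j ≫ s) V := by
  have h' := (h.openImmersion_comp j).openImmersion_comp V.ι
  exact (μ.cl_iso _ _ (j.isoImage V) h'.lft h'.qc h'.sep (by simp)).symm

lemma opn_eq_preimage (h : IsVarietyStr s) (j : Y ⟶ X) [IsOpenImmersion j] {V : X.Opens}
    (hV : V ≤ j.opensRange) : μ.opn s V = μ.opn (j ≫ s) (j ⁻¹ᵁ V) := by
  rw [← μ.opn_image h, Scheme.Hom.image_preimage_eq_opensRange_inf, inf_eq_right.mpr hV]

lemma opn_opensRange (h : IsVarietyStr s) (j : Y ⟶ X) [IsOpenImmersion j] :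
    μ.opn s j.opensRange = μ.cl Y (j ≫ s) := by
  rw [μ.opn_eq_preimage h j le_rfl, Scheme.Hom.preimage_opensRange,
    μ.cl_eq_opn_top (h.openImmersion_comp j)]

lemma cl_eq_opn_add (h : IsVarietyStr s) (i : Z ⟶ X) [IsClosedImmersion i] {V : X.Opens}
    (hV : (V : Set X) = (Set.range i)ᶜ) : μ.cl X s = μ.opn s V + μ.cl Z (i ≫ s) :=
  μ.cl_scissor s i h.lft h.qc h.sep inferInstance V hV

lemma opn_bot (h : IsVarietyStr s) : μ.opn s ⊥ = 0 := by
  simpa using μ.cl_eq_opn_add h (𝟙 X) (V := ⊥) (by simp)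

lemma opn_eq_inf_add (h : IsVarietyStr s) (i : Z ⟶ X) [IsClosedImmersion i] {V : X.Opens}
    (hV : (V : Set X) = (Set.range i)ᶜ) (V' : X.Opens) :
    μ.opn s V' = μ.opn s (V' ⊓ V) + μ.opn (i ≫ s) (i ⁻¹ᵁ V') := by
  have hι (z : Z) (hz : i z ∈ V') : V'.ι ((i ∣_ V') ⟨z, hz⟩) = i z := by
    exact congr($(morphismRestrict_ι i V') ⟨z, hz⟩)
  have key := μ.cl_eq_opn_add (h.openImmersion_comp V'.ι) (i ∣_ V') (V := V'.ι ⁻¹ᵁ V) (by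
    ext x
    have hx : V'.ι x ∈ V ↔ V'.ι x ∉ Set.range i := Set.ext_iff.mp hV _
    refine hx.trans (not_congr ⟨?_, ?_⟩)
    · rintro ⟨z, hz⟩
      have hz' : i z ∈ V' := hz ▸ x.2
      exact ⟨⟨z, hz'⟩, V'.ι.isOpenEmbedding.injective ((hι z hz').trans hz)⟩
    · rintro ⟨⟨z, hz⟩, rfl⟩
      exact ⟨z, (hι z hz).symm⟩)
  have hinf : V'.ι ⁻¹ᵁ (V' ⊓ V) = V'.ι ⁻¹ᵁ V := by
    ext x
    exact and_iff_right x.2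
  rw [μ.opn_eq_preimage (V := V' ⊓ V) h V'.ι (by simp), hinf, opn, key]
  simp [opn]

lemma exists_closed (V : X.Opens) : ∃ (Z : Scheme.{u}) (i : Z ⟶ X), IsClosedImmersion i ∧
    (V : Set X) = (Set.range i)ᶜ :=
  ⟨_, (Scheme.IdealSheafData.vanishingIdeal (X := X)
    ⟨(V : Set X)ᶜ, V.isOpen.isClosed_compl⟩).subschemeι, inferInstance, by
      rw [Scheme.IdealSheafData.range_subschemeι]; simp⟩

lemma opn_sup_add_opn_inf (h : IsVarietyStr s) (V V' : X.Opens) :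
    μ.opn s (V ⊔ V') + μ.opn s (V ⊓ V') = μ.opn s V + μ.opn s V' := by
  obtain ⟨Z, i, hi, hV⟩ := exists_closed V
  have h1 := μ.opn_eq_inf_add h i hV V'
  have h2 := μ.opn_eq_inf_add h i hV (V ⊔ V')
  have h3 : i ⁻¹ᵁ (V ⊔ V') = i ⁻¹ᵁ V' := by
    ext z
    have : i z ∉ V := fun hz ↦ (hV.le hz) ⟨z, rfl⟩
    simp [this]
  rw [h3, inf_eq_right.mpr (le_sup_left : V ≤ V ⊔ V')] at h2
  rw [inf_comm, h1, h2]
  ring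

end MotivicMeasure

/-- The structure morphism of `Spec A` for a `k`-algebra `A`. -/
def specStr {k A : Type u} [Field k] [CommRing A] (φ : k →+* A) :
    Spec (CommRingCat.of A) ⟶ SpecBase k := Spec.map (CommRingCat.ofHom φ)

lemma specMap_comp_specStr {k A B : Type u} [Field k] [CommRing A] [CommRing B] (φ : k →+* A)
    (ψ : A →+* B) : Spec.map (CommRingCat.ofHom ψ) ≫ specStr φ = specStr (ψ.comp φ) := by
  simp [specStr, ← Spec.map_comp]

/-- The basic open subset `D(g)` of `Spec A`. -/
def specBasicOpen {A : Type u} [CommRing A] (g : A) : (Spec (CommRingCat.of A)).Opens :=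
  PrimeSpectrum.basicOpen g

section specBasicOpen

variable {A B : Type u} [CommRing A] [CommRing B]

lemma mem_specBasicOpen {g : A} {p : PrimeSpectrum A} : p ∈ specBasicOpen g ↔ g ∉ p.asIdeal :=
  Iff.rfl

lemma specMap_preimage_specBasicOpen (ψ : A →+* B) (g : A) :
    Spec.map (CommRingCat.ofHom ψ) ⁻¹ᵁ specBasicOpen g = specBasicOpen (ψ g) := rfl

lemma specBasicOpen_mul (g h : A) : specBasicOpen (g * h) = specBasicOpen g ⊓ specBasicOpen h :=
  PrimeSpectrum.basicOpen_mul g h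

lemma specBasicOpen_of_isUnit {g : A} (h : IsUnit g) : specBasicOpen g = ⊤ := by
  ext p
  exact iff_of_true (fun hp ↦ p.isPrime.ne_top (Ideal.eq_top_of_isUnit_mem _ hp h)) trivial

lemma opensRange_specMap_algebraMap [Algebra A B] (g : A) [IsLocalization.Away g B]
    [IsOpenImmersion (Spec.map (CommRingCat.ofHom (algebraMap A B)))] :
    (Spec.map (CommRingCat.ofHom (algebraMap A B))).opensRange = specBasicOpen g := by
  ext1
  exact PrimeSpectrum.localization_away_comap_range B g

end specBasicOpen

namespace MotivicMeasure

variable {k : Type u} [Field k] {R : Type v} [CommRing R] (μ : MotivicMeasure k R)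
  {A B : Type u} [CommRing A] [CommRing B] {φ : k →+* A}

lemma cl_spec_eq_opn_add (h : IsVarietyStr (specStr φ)) {ψ : A →+* B}
    (hψ : Function.Surjective ψ) {V : (Spec (CommRingCat.of A)).Opens}
    (hV : ∀ p : PrimeSpectrum A, p ∈ V ↔ ¬ RingHom.ker ψ ≤ p.asIdeal) :
    μ.cl _ (specStr φ) = μ.opn (specStr φ) V + μ.cl _ (specStr (ψ.comp φ)) := by
  rw [← specMap_comp_specStr]
  have := IsClosedImmersion.spec_of_surjective (CommRingCat.ofHom ψ) hψ
  refine μ.cl_eq_opn_add h _ ?_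
  ext p
  refine (hV p).trans (not_congr ?_)
  exact (Set.ext_iff.mp (range_comap_of_surjective B ψ hψ) p).symm

lemma opn_eq_cl_spec [Algebra A B] (h : IsVarietyStr (specStr φ)) (g : A)
    [IsLocalization.Away g B] :
    μ.opn (specStr φ) (specBasicOpen g) =
      μ.cl _ (specStr ((algebraMap A B).comp φ)) := by
  rw [← specMap_comp_specStr]
  have := IsOpenImmersion.of_isLocalization (S := B) g
  rw [← μ.opn_opensRange h, opensRange_specMap_algebraMap g]

lemma opn_inf_eq_opn [Algebra A B] (h : IsVarietyStr (specStr φ)) (f g : A)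
    [IsLocalization.Away g B] :
    μ.opn (specStr φ) (specBasicOpen f ⊓ specBasicOpen g) =
      μ.opn (specStr ((algebraMap A B).comp φ)) (specBasicOpen (algebraMap A B f)) := by
  rw [← specMap_comp_specStr]
  have := IsOpenImmersion.of_isLocalization (S := B) g
  rw [μ.opn_eq_preimage h (Spec.map (CommRingCat.ofHom (algebraMap A B)))
    (by rw [opensRange_specMap_algebraMap g]; exact inf_le_right), ← specBasicOpen_mul,
    specMap_preimage_specBasicOpen, map_mul, specBasicOpen_mul,
    specBasicOpen_of_isUnit (IsLocalization.Away.algebraMap_isUnit g), inf_top_eq]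

lemma _root_.RingHom.FiniteType.polynomialC_comp (h : φ.FiniteType) :
    (Polynomial.C.comp φ).FiniteType :=
  (RingHom.finiteType_algebraMap (A := A) (B := Polynomial A)).mpr inferInstance |>.comp h

lemma cl_spec_polynomial (h : φ.FiniteType) :
    μ.cl _ (specStr (Polynomial.C.comp φ)) = μ.lef * μ.cl _ (specStr φ) := by
  algebraize [φ]
  let := Polynomial.algebra k A
  have h1 := CommRingCat.isPushout_of_isPushout k (Polynomial k) A (Polynomial A)
  have h2 := isPullback_SpecMap_of_isPushout _ _ _ _ h1
  have hA : IsVarietyStr (specStr φ) := .specMap h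
  have hk : IsVarietyStr (AffineLine.toSpec k) :=
    .specMap (RingHom.finiteType_algebraMap.mpr inferInstance)
  have hA' : IsVarietyStr (specStr (Polynomial.C.comp φ)) := .specMap h.polynomialC_comp
  rw [lef, ← μ.cl_prod _ _ hk.lft hk.qc hk.sep hA.lft hA.qc hA.sep]
  refine μ.cl_iso _ _ h2.isoPullback hA'.lft hA'.qc hA'.sep ?_
  refine (h2.isoPullback_hom_fst_assoc _).trans ?_
  refine h2.w.trans (specMap_comp_specStr φ _)

/-- The class of the hypersurface `t g₂ + g₃ = 0` in `Spec A × 𝔸¹`. -/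
lemma cl_spec_polynomial_eq (h : φ.FiniteType) (g₂ g₃ : A) :
    μ.cl _ (specStr (Polynomial.C.comp φ)) =
      μ.opn (specStr (Polynomial.C.comp φ))
        (specBasicOpen (Polynomial.X * Polynomial.C g₂ + Polynomial.C g₃)) +
      μ.opn (specStr φ) (specBasicOpen g₂) +
      μ.lef * (μ.cl _ (specStr φ) -
        μ.opn (specStr φ) (specBasicOpen g₂ ⊔ specBasicOpen g₃)) := by
  have hA : IsVarietyStr (specStr φ) := .specMap h
  have hA' : IsVarietyStr (specStr (Polynomial.C.comp φ)) := .specMap h.polynomialC_comp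
  set F : Polynomial A := Polynomial.X * Polynomial.C g₂ + Polynomial.C g₃
  -- the closed part `g₂ = g₃ = 0`
  let q := Ideal.Quotient.mk (Ideal.span {g₂, g₃})
  have hq : Function.Surjective q := Ideal.Quotient.mk_surjective
  have e1 := μ.cl_spec_eq_opn_add hA hq
    (V := specBasicOpen g₂ ⊔ specBasicOpen g₃) (by
      intro p
      rw [Ideal.mk_ker, Ideal.span_le, Set.pair_subset_iff, not_and_or]
      rfl)
  have e2 := μ.cl_spec_eq_opn_add hA' (Polynomial.map_surjective q hq)
    (ψ := Polynomial.mapRingHom q)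
    (V := specBasicOpen F ⊔ specBasicOpen (Polynomial.C g₂)) (by
      intro p
      rw [Polynomial.ker_mapRingHom, Ideal.mk_ker, Ideal.map_span, Ideal.span_le, Set.image_pair,
        Set.pair_subset_iff, not_and_or]
      change F ∉ p.asIdeal ∨ Polynomial.C g₂ ∉ p.asIdeal ↔
        Polynomial.C g₂ ∉ p.asIdeal ∨ Polynomial.C g₃ ∉ p.asIdeal
      by_cases h2 : Polynomial.C g₂ ∈ p.asIdeal
      · have := Ideal.add_mem_iff_right _ (Ideal.mul_mem_left _ Polynomial.X h2)
          (b := Polynomial.C g₃)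
        simp only [h2, not_true, or_false, false_or, F, this]
      · simp [h2])
  have e3 := μ.cl_spec_polynomial (φ := q.comp φ) (.comp (.of_surjective _ hq) h)
  have e4 : (Polynomial.mapRingHom q).comp (Polynomial.C.comp φ) =
      Polynomial.C.comp (q.comp φ) := by ext; simp
  -- the open part `g₂ ≠ 0`
  let B := Localization.Away g₂
  let := Polynomial.algebra A B
  have hloc : IsLocalization.Away (Polynomial.C g₂) (Polynomial B) := by
    have := Polynomial.isLocalization (.powers g₂) B
    rwa [Submonoid.map_powers] at this
  let l := algebraMap A B
  have e5 := μ.opn_eq_cl_spec (B := B) hA g₂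
  have e6 := μ.opn_eq_cl_spec (B := Polynomial B) hA' (Polynomial.C g₂)
  have e7 := μ.opn_inf_eq_opn (B := Polynomial B) hA' F (Polynomial.C g₂)
  obtain ⟨u, hu⟩ : ∃ u : B, l g₂ * u = 1 :=
    (IsLocalization.Away.algebraMap_isUnit (S := B) g₂).exists_right_inv
  have hB : IsVarietyStr
      (specStr ((algebraMap (Polynomial A) (Polynomial B)).comp (Polynomial.C.comp φ))) := by
    have := IsOpenImmersion.of_isLocalization (S := Polynomial B) (Polynomial.C g₂)
    rw [← specMap_comp_specStr]
    exact hA'.openImmersion_comp _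
  have e8 := μ.cl_spec_eq_opn_add hB (ψ := Polynomial.evalRingHom (- (l g₃ * u)))
    (fun b ↦ ⟨Polynomial.C b, by simp⟩)
    (V := specBasicOpen (algebraMap (Polynomial A) (Polynomial B) F)) (by
      intro p
      rw [Polynomial.ker_evalRingHom, Ideal.span_le, Set.singleton_subset_iff]
      have hF : algebraMap (Polynomial A) (Polynomial B) F =
          Polynomial.X * Polynomial.C (l g₂) + Polynomial.C (l g₃) := by
        simp [F, Polynomial.algebraMap_def, l]
      have hu' : Polynomial.C (l g₂) * Polynomial.C u = 1 := by rw [← map_mul, hu, map_one]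
      have hC : Polynomial.C (-(l g₃ * u)) = -(Polynomial.C (l g₃) * Polynomial.C u) := by
        rw [Polynomial.C_neg, Polynomial.C_mul]
      rw [hF, mem_specBasicOpen, not_iff_not, SetLike.mem_coe]
      constructor <;> intro hp
      · convert p.asIdeal.mul_mem_left (Polynomial.C u) hp using 1
        linear_combination (- Polynomial.X) * hu' - hC
      · convert p.asIdeal.mul_mem_left (Polynomial.C (l g₂)) hp using 1
        linear_combination (- Polynomial.C (l g₃)) * hu' + Polynomial.C (l g₂) * hC)
  have e9 : (Polynomial.evalRingHom (- (l g₃ * u))).comp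
      ((algebraMap (Polynomial A) (Polynomial B)).comp (Polynomial.C.comp φ)) = l.comp φ := by
    ext; simp [l]
  have e10 := μ.opn_sup_add_opn_inf hA' (specBasicOpen F)
    (specBasicOpen (Polynomial.C g₂))
  rw [e4, e3] at e2
  rw [e9] at e8
  linear_combination e2 + e10 - e7 + e6 + e8 - e5 - μ.lef * e1

end MotivicMeasure

open HomogeneousLocalization in
/-- The degree zero part of the localization of a polynomial ring at `h`. -/
abbrev Chart {k : Type u} [Field k] {σ : Type} (h : MvPolynomial σ k) : Type u :=
  Away (homogeneousSubmodule σ k) h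

namespace Chart

open HomogeneousLocalization

variable {k : Type u} [Field k] {σ : Type}

/-- The `k`-algebra structure of a chart. -/
def str (h : MvPolynomial σ k) : k →+* Chart h :=
  (fromZeroRingHom (homogeneousSubmodule σ k) (.powers h)).comp
    (algebraMap k (homogeneousSubmodule σ k 0))

lemma val_str (h : MvPolynomial σ k) (c : k) :
    (str h c).val = algebraMap (MvPolynomial σ k) _ (C c) := by
  rw [← Localization.mk_one_eq_algebraMap]
  rfl

lemma val_ringHom_injective (h : MvPolynomial σ k) :
    Function.Injective (algebraMap (Chart h) (Localization.Away h)) := val_injective _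

/-- The fraction `x / h ^ n`. -/
def mk {h : MvPolynomial σ k} {d : ℕ} (hh : h.IsHomogeneous d) (n : ℕ) (x : MvPolynomial σ k)
    (hx : x.IsHomogeneous (n * d)) : Chart h :=
  Away.mk (homogeneousSubmodule σ k) hh n x hx

lemma val_mk {h : MvPolynomial σ k} {d : ℕ} (hh : h.IsHomogeneous d) (n : ℕ)
    (x : MvPolynomial σ k) (hx : x.IsHomogeneous (n * d)) :
    (mk hh n x hx).val = Localization.mk x (⟨h ^ n, n, rfl⟩ : Submonoid.powers h) := rfl

lemma exists_eq_mk {h : MvPolynomial σ k} {d : ℕ} (hh : h.IsHomogeneous d) (a : Chart h) :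
    ∃ n x hx, a = mk hh n x hx := by
  obtain ⟨n, x, hx, rfl⟩ := Away.mk_surjective _ hh a
  exact ⟨n, x, hx, rfl⟩

lemma str_eq_mk {h : MvPolynomial σ k} {d : ℕ} (hh : h.IsHomogeneous d) (c : k) :
    str h c = mk hh 0 (C c) (by simpa using isHomogeneous_C σ c) := by
  apply val_injective
  rw [val_str, val_mk, ← Localization.mk_one_eq_algebraMap]
  congr 1

lemma _root_.MvPolynomial.IsHomogeneous.eval₂_mul {A B : Type*} [CommSemiring A] [CommSemiring B]
    {x : MvPolynomial σ A} {c : ℕ} (hx : x.IsHomogeneous c) (f : A →+* B) (g : σ → B) (t : B) :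
    x.eval₂ f (fun i ↦ g i * t) = x.eval₂ f g * t ^ c := by
  rw [eval₂_eq, eval₂_eq, Finset.sum_mul]
  refine Finset.sum_congr rfl fun d hd ↦ ?_
  simp_rw [mul_pow, Finset.prod_mul_distrib, Finset.prod_pow_eq_pow_sum]
  rw [← hx.degree_eq_sum_deg_support hd]
  ring

variable {s h : MvPolynomial σ k} {e : ℕ} (hs : s.IsHomogeneous 1) (hh : h.IsHomogeneous e)

/-- The dehomogenization `x ↦ x(X / s)`. -/
def dehom : MvPolynomial σ k →+* Chart (s * h) :=
  eval₂Hom (str _) fun i ↦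
    mk (hs.mul hh) 1 (X i * h)
      (by simpa using (isHomogeneous_X k i).mul hh)

lemma dehom_C (c : k) : dehom hs hh (C c) = str _ c := eval₂Hom_C _ _ _

lemma val_dehom {x : MvPolynomial σ k} {c : ℕ} (hx : x.IsHomogeneous c) :
    (dehom hs hh x).val = algebraMap (MvPolynomial σ k) (Localization.Away (s * h)) x *
      Localization.mk h (⟨s * h, 1, pow_one _⟩ : Submonoid.powers (s * h)) ^ c := by
  have h1 : (algebraMap (Chart (s * h)) (Localization.Away (s * h))).comp (dehom hs hh) =
      eval₂Hom ((algebraMap (MvPolynomial σ k) (Localization.Away (s * h))).comp C)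
        (fun i ↦ algebraMap (MvPolynomial σ k) _ (X i) *
          Localization.mk h (⟨s * h, 1, pow_one _⟩ : Submonoid.powers (s * h))) := by
    ext i
    · simp [dehom_C, val_str]
    · simp [dehom, val_mk, ← Localization.mk_one_eq_algebraMap, Localization.mk_mul]
  refine (RingHom.congr_fun h1 x).trans ((hx.eval₂_mul _ _ _).trans ?_)
  congr 1
  have h2 : eval₂Hom ((algebraMap (MvPolynomial σ k) (Localization.Away (s * h))).comp C)
      (fun i ↦ algebraMap (MvPolynomial σ k) _ (X i)) = algebraMap _ _ := by ext <;> simp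
  exact congr($h2 x)

/-- The unit `s ^ (e + 1) / (s * h)`. -/
def unit : Chart (s * h) :=
  mk (hs.mul hh) 1 (s ^ (1 + e))
    (by simpa using hs.pow (1 + e))

/-- The inverse of `Chart.unit`. -/
def unitInv : Chart (s * h) :=
  mk (hs.mul hh) e (h ^ (1 + e))
    (by simpa [mul_comm] using hh.pow (1 + e))

lemma unit_mul_unitInv : unit hs hh * unitInv hs hh = 1 := by
  apply val_injective
  simp only [unit, unitInv, val_mul, val_mk, val_one, Localization.mk_mul,
    ← Localization.mk_one, Localization.mk_eq_mk_iff, Localization.r_iff_exists]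
  refine ⟨1, ?_⟩
  simp
  ring

lemma exists_eq_dehom_mul (a : Chart (s * h)) :
    ∃ (x : MvPolynomial σ k) (n : ℕ), a = dehom hs hh x * unit hs hh ^ n := by
  obtain ⟨n, x, hx, rfl⟩ := exists_eq_mk (hs.mul hh) a
  refine ⟨x, n, val_injective _ ?_⟩
  rw [val_mul, val_dehom hs hh hx, val_pow]
  simp only [unit, val_mk, Localization.mk_mul, Localization.mk_pow,
    ← Localization.mk_one_eq_algebraMap, Localization.mk_eq_mk_iff, Localization.r_iff_exists]
  refine ⟨1, ?_⟩
  simp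
  ring

lemma specBasicOpen_dehom {g : MvPolynomial σ k} {c : ℕ} (hg : g.IsHomogeneous c) :
    specBasicOpen (mk (hs.mul hh) c (g ^ (1 + e)) (by simpa [mul_comm] using hg.pow (1 + e))) =
      specBasicOpen (dehom hs hh g) := by
  have key : dehom hs hh g ^ (1 + e) =
      mk (hs.mul hh) c (g ^ (1 + e)) (by simpa [mul_comm] using hg.pow (1 + e)) *
        unitInv hs hh ^ c := by
    apply val_injective
    rw [val_mul, val_pow, val_dehom hs hh hg, val_pow]
    simp only [unitInv, val_mk, Localization.mk_mul, Localization.mk_pow,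
      ← Localization.mk_one_eq_algebraMap, Localization.mk_eq_mk_iff, Localization.r_iff_exists]
    refine ⟨1, ?_⟩
    simp
    ring
  have hu : IsUnit (unitInv hs hh) := .of_mul_eq_one_right _ (unit_mul_unitInv hs hh)
  have h1 := congr(specBasicOpen $key)
  rw [specBasicOpen_mul, specBasicOpen_of_isUnit (hu.pow c), inf_top_eq] at h1
  rw [← h1]
  exact PrimeSpectrum.basicOpen_pow _ _ (by omega)

end Chart

namespace Chart

open HomogeneousLocalization

variable {k : Type u} [Field k] {n : ℕ} {s h : MvPolynomial (Fin n) k} {e : ℕ}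
  (hs : s.IsHomogeneous 1) (hh : h.IsHomogeneous e)

/-- The inclusion of polynomial rings `k[x₀, …, xₙ₋₁] → k[x₀, …, xₙ]`, as a graded map. -/
def renameGraded (k : Type u) [Field k] (n : ℕ) :
    GradedRingHom (homogeneousSubmodule (Fin n) k) (homogeneousSubmodule (Fin (n + 1)) k) where
  __ := (rename (R := k) (Fin.castSucc (n := n))).toRingHom
  map_mem hx := IsHomogeneous.rename_isHomogeneous hx

/-- The pullback along the projection from `[0 : ⋯ : 0 : 1]`. -/
def proj (s h : MvPolynomial (Fin n) k) :
    Chart (s * h) →+* Chart (rename Fin.castSucc s * rename Fin.castSucc h) :=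
  HomogeneousLocalization.map (renameGraded k n) <| by
    rintro _ ⟨m, rfl⟩
    exact ⟨m, by simp [renameGraded]⟩

lemma proj_mk {d : ℕ} (hd : (s * h).IsHomogeneous d) (m : ℕ) (x : MvPolynomial (Fin n) k)
    (hx : x.IsHomogeneous (m * d)) :
    proj s h (mk hd m x hx) =
      mk (by simpa using hd.rename_isHomogeneous (f := Fin.castSucc)) m (rename Fin.castSucc x)
        hx.rename_isHomogeneous := by
  apply val_injective
  rw [val_mk, mk, proj]
  refine (congrArg val (map_mk _ _ _)).trans ((HomogeneousLocalization.val_mk _).trans ?_)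
  congr 1
  ext1
  simp [renameGraded]

include hs hh in
lemma proj_comp_str : (proj s h).comp (str _) = str _ := by
  ext1 c
  rw [RingHom.comp_apply, str_eq_mk (hs.mul hh), proj_mk,
    str_eq_mk (hs.rename_isHomogeneous.mul hh.rename_isHomogeneous)]
  simp

/-- The dehomogenization of `k[x₀, …, xₙ]` as a polynomial ring over a chart. -/
def dehomLast : MvPolynomial (Fin (n + 1)) k →+* Polynomial (Chart (s * h)) :=
  eval₂Hom (Polynomial.C.comp (str _))
    (Fin.lastCases Polynomial.X fun i ↦ Polynomial.C (dehom hs hh (X i)))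

lemma dehomLast_rename (x : MvPolynomial (Fin n) k) :
    dehomLast hs hh (rename Fin.castSucc x) = Polynomial.C (dehom hs hh x) := by
  suffices (dehomLast hs hh).comp (rename Fin.castSucc).toRingHom =
      Polynomial.C.comp (dehom hs hh) from congr($this x)
  ext <;> simp [dehomLast, dehom_C]

lemma dehomLast_X_last : dehomLast hs hh (X (Fin.last n)) = Polynomial.X := by
  simp [dehomLast]

/-- The map from the polynomial ring over a chart of `ℙⁿ⁻¹` to the chart of `ℙⁿ`. -/
def ofPolynomial : Polynomial (Chart (s * h)) →+*
    Chart (rename Fin.castSucc s * rename Fin.castSucc h) :=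
  Polynomial.eval₂RingHom (proj s h)
    (dehom hs.rename_isHomogeneous hh.rename_isHomogeneous (X (Fin.last n)))

lemma ofPolynomial_dehomLast (x : MvPolynomial (Fin (n + 1)) k) :
    ofPolynomial hs hh (dehomLast hs hh x) =
      dehom hs.rename_isHomogeneous hh.rename_isHomogeneous x := by
  suffices (ofPolynomial hs hh).comp (dehomLast hs hh) = dehom _ _ from congr($this x)
  ext i
  · simp [dehomLast, ofPolynomial, dehom_C, ← proj_comp_str hs hh]
  · induction i using Fin.lastCases with
    | last => simp [dehomLast, ofPolynomial]
    | cast i =>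
      simp [dehomLast, ofPolynomial, dehom, proj_mk]

lemma ofPolynomial_comp_C_comp_str :
    (ofPolynomial hs hh).comp (Polynomial.C.comp (str _)) = str _ := by
  rw [← proj_comp_str hs hh]
  ext
  simp [ofPolynomial]

lemma ofPolynomial_surjective : Function.Surjective (ofPolynomial hs hh) := by
  intro a
  obtain ⟨x, m, rfl⟩ :=
    exists_eq_dehom_mul hs.rename_isHomogeneous hh.rename_isHomogeneous a
  refine ⟨dehomLast hs hh x * Polynomial.C (unit hs hh) ^ m, ?_⟩
  rw [map_mul, ofPolynomial_dehomLast, map_pow]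
  simp [ofPolynomial, unit, proj_mk]

lemma ofPolynomial_injective : Function.Injective (ofPolynomial hs hh) := by
  let L := Localization.Away (s * h)
  let l : MvPolynomial (Fin n) k →+* L := algebraMap _ _
  let T : MvPolynomial (Fin (n + 1)) k →+* Polynomial L :=
    eval₂Hom (Polynomial.C.comp (l.comp C))
      (Fin.lastCases (Polynomial.C (l s) * Polynomial.X) fun i ↦ Polynomial.C (l (X i)))
  have hT (x) : T (rename Fin.castSucc x) = Polynomial.C (l x) := by
    suffices T.comp (rename Fin.castSucc).toRingHom = Polynomial.C.comp l from congr($this x)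
    ext <;> simp [T]
  let r := rename (R := k) Fin.castSucc s * rename Fin.castSucc h
  have hTr : T r = Polynomial.C (l (s * h)) := by simp only [r, ← map_mul, hT]
  have hu : IsUnit (T r) := by
    rw [hTr]
    exact (IsLocalization.Away.algebraMap_isUnit (S := L) (s * h)).map Polynomial.C
  let Θ : Chart (rename Fin.castSucc s * rename Fin.castSucc h) →+* Polynomial L :=
    (IsLocalization.Away.lift (S := Localization.Away r) r hu).comp (algebraMap _ _)
  have hΘ {m d : ℕ} (x : MvPolynomial (Fin (n + 1)) k)
      (hd : (rename Fin.castSucc s * rename Fin.castSucc h).IsHomogeneous d)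
      (hx : x.IsHomogeneous (m * d)) : Θ (mk hd m x hx) *
      T r ^ m = T x := by
    rw [← IsLocalization.Away.lift_eq (S := Localization.Away r) r hu,
      ← IsLocalization.Away.lift_eq (S := Localization.Away r) r hu x, ← map_pow]
    refine (map_mul (IsLocalization.Away.lift (S := Localization.Away r) r hu) _ _).symm.trans ?_
    congr 1
    rw [HomogeneousLocalization.algebraMap_apply, val_mk, Localization.mk_eq_mk', ← map_pow]
    exact IsLocalization.mk'_spec _ _ _
  have key : Θ.comp (ofPolynomial hs hh) = Polynomial.mapRingHom (algebraMap _ _) := by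
    refine Polynomial.ringHom_ext (fun a ↦ ?_) ?_
    · obtain ⟨m, x, hx, rfl⟩ := exists_eq_mk (hs.mul hh) a
      apply (hu.pow m).mul_right_cancel
      simp only [ofPolynomial, RingHom.comp_apply, Polynomial.coe_eval₂RingHom,
        Polynomial.eval₂_C, proj_mk, hΘ]
      rw [hT, hTr]
      rw [Polynomial.coe_mapRingHom, Polynomial.map_C, ← map_pow, ← map_mul, ← map_pow]
      refine congrArg _ (Eq.symm ?_)
      rw [HomogeneousLocalization.algebraMap_apply, val_mk, Localization.mk_eq_mk']
      exact IsLocalization.mk'_spec _ _ _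
    · apply (hu.pow 1).mul_right_cancel
      simp only [ofPolynomial, RingHom.comp_apply, Polynomial.coe_eval₂RingHom,
        Polynomial.eval₂_X, dehom, eval₂Hom_X', hΘ]
      rw [map_mul, hT, hTr]
      simp [T]
      ring
  refine .of_comp (f := Θ) ?_
  rw [← RingHom.coe_comp, key]
  exact Polynomial.map_injective _ (val_ringHom_injective _)

end Chart

lemma algebraMap_homogeneousSubmodule_zero_surjective_s19 {k : Type u} [Field k] {σ : Type} :
    Function.Surjective (algebraMap k (homogeneousSubmodule σ k 0)) := by
  rintro ⟨x, hx⟩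
  have hx' : x.IsHomogeneous 0 := hx
  refine ⟨coeff 0 x, Subtype.ext ?_⟩
  exact (totalDegree_eq_zero_iff_eq_C.mp (Nat.le_zero.mp hx'.totalDegree_le)).symm

instance {k : Type u} [Field k] {σ : Type} :
    IsScalarTower k (homogeneousSubmodule σ k 0) (MvPolynomial σ k) :=
  ⟨fun a b c ↦ smul_mul_assoc a (b : MvPolynomial σ k) c⟩

instance {k : Type u} [Field k] {σ : Type} [Finite σ] :
    Algebra.FiniteType (homogeneousSubmodule σ k 0) (MvPolynomial σ k) :=
  .of_restrictScalars_finiteType k _ _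

lemma Chart.finiteType_str {k : Type u} [Field k] {σ : Type} [Finite σ] {h : MvPolynomial σ k}
    {d : ℕ} (hh : h.IsHomogeneous d) : (Chart.str h).FiniteType := by
  have := HomogeneousLocalization.Away.finiteType (𝒜 := homogeneousSubmodule σ k) h d hh
  exact (RingHom.finiteType_algebraMap.mpr this).comp
    (.of_surjective _ algebraMap_homogeneousSubmodule_zero_surjective_s19)

namespace ProjSpace

variable {k : Type u} [Field k] {n : ℕ}

lemma isVarietyStr_toSpec : IsVarietyStr (ProjSpace.toSpec k n) := by
  have h := (IsVarietyStr.specMap (.of_surjective _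
    (algebraMap_homogeneousSubmodule_zero_surjective_s19 (k := k) (σ := Fin (n + 1)))))
  have := h.lft
  have := h.qc
  have := h.sep
  have h1 : LocallyOfFiniteType (Proj.toSpecZero (homogeneousSubmodule (Fin (n + 1)) k)) :=
    inferInstance
  have h2 : QuasiCompact (Proj.toSpecZero (homogeneousSubmodule (Fin (n + 1)) k)) :=
    inferInstance
  have h3 : IsSeparated (Proj.toSpecZero (homogeneousSubmodule (Fin (n + 1)) k)) :=
    inferInstance
  exact ⟨MorphismProperty.comp_mem @LocallyOfFiniteType _ _ h1 h.lft,
    MorphismProperty.comp_mem @QuasiCompact _ _ h2 h.qc,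
    MorphismProperty.comp_mem @IsSeparated _ _ h3 h.sep⟩

/-- The open subset `D₊(g)` of projective space. -/
def basicOpen (g : MvPolynomial (Fin (n + 1)) k) : (ProjSpace k n).Opens :=
  Proj.basicOpen (homogeneousSubmodule (Fin (n + 1)) k) g

lemma basicOpen_mul (f g : MvPolynomial (Fin (n + 1)) k) :
    basicOpen (f * g) = basicOpen f ⊓ basicOpen g := Proj.basicOpen_mul _ _ _

lemma iSup_basicOpen_X : ⨆ i, basicOpen (X i : MvPolynomial (Fin (n + 1)) k) = ⊤ := by
  refine Proj.iSup_basicOpen_eq_top' _ _ (fun i ↦ ⟨1, isHomogeneous_X k i⟩) (top_le_iff.mp ?_)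
  intro x _
  induction x using MvPolynomial.induction_on with
  | C a =>
    exact Subalgebra.algebraMap_mem _ (algebraMap k (homogeneousSubmodule (Fin (n + 1)) k 0) a)
  | add p q hp hq => exact add_mem (hp trivial) (hq trivial)
  | mul_X p i hp => exact mul_mem (hp trivial) (Algebra.subset_adjoin ⟨i, rfl⟩)

end ProjSpace

namespace Chart

variable {k : Type u} [Field k] {n : ℕ} {s h : MvPolynomial (Fin (n + 1)) k} {e : ℕ}
  (hs : s.IsHomogeneous 1) (hh : h.IsHomogeneous e)

include hs hh in
lemma mul_mem : s * h ∈ homogeneousSubmodule (Fin (n + 1)) k (1 + e) := hs.mul hh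

/-- The open immersion of a chart. -/
def toProj : Spec (CommRingCat.of (Chart (s * h))) ⟶ ProjSpace k n :=
  Proj.awayι (homogeneousSubmodule (Fin (n + 1)) k) (s * h)
    (mul_mem hs hh) (by omega : 0 < 1 + e)

instance : IsOpenImmersion (toProj hs hh) :=
  inferInstanceAs (IsOpenImmersion (Proj.awayι _ _ (mul_mem hs hh) _))

lemma opensRange_toProj : (toProj hs hh).opensRange = ProjSpace.basicOpen (s * h) :=
  Proj.opensRange_awayι _ _ _ _

lemma toProj_comp_toSpec : toProj hs hh ≫ ProjSpace.toSpec k n = specStr (str (s * h)) := by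
  refine (Proj.awayι_toSpecZero_assoc _ _ _ _ _).trans ?_
  rw [← Spec.map_comp]
  rfl

lemma toProj_preimage_basicOpen {g : MvPolynomial (Fin (n + 1)) k} {c : ℕ}
    (hg : g.IsHomogeneous c) (hc : 0 < c) :
    toProj hs hh ⁻¹ᵁ ProjSpace.basicOpen g = specBasicOpen (dehom hs hh g) :=
  (Proj.awayι_preimage_basicOpen (homogeneousSubmodule (Fin (n + 1)) k)
    (hs.mul hh) (by omega) hg hc).trans (specBasicOpen_dehom hs hh hg)

end Chart

namespace MotivicMeasure

variable {k : Type u} [Field k] {R : Type v} [CommRing R] (μ : MotivicMeasure k R)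
  {n : ℕ} {s h : MvPolynomial (Fin (n + 1)) k} {e : ℕ}
  (hs : s.IsHomogeneous 1) (hh : h.IsHomogeneous e)

include hs hh

lemma opn_basicOpen :
    μ.opn (ProjSpace.toSpec k n) (ProjSpace.basicOpen (s * h)) =
      μ.cl _ (specStr (Chart.str (s * h))) := by
  rw [← Chart.opensRange_toProj hs hh, μ.opn_opensRange ProjSpace.isVarietyStr_toSpec,
    Chart.toProj_comp_toSpec]

lemma opn_basicOpen_inf (V : (ProjSpace k n).Opens) :
    μ.opn (ProjSpace.toSpec k n) (ProjSpace.basicOpen (s * h) ⊓ V) =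
      μ.opn (specStr (Chart.str (s * h))) (Chart.toProj hs hh ⁻¹ᵁ V) := by
  rw [← Chart.toProj_comp_toSpec hs hh, ← μ.opn_image ProjSpace.isVarietyStr_toSpec,
    Scheme.Hom.image_preimage_eq_opensRange_inf, Chart.opensRange_toProj]

end MotivicMeasure

lemma MotivicMeasure.opn_specMap_bijective {k A B : Type u} [Field k] [CommRing A] [CommRing B]
    {R : Type v} [CommRing R] (μ : MotivicMeasure k R) {φ : k →+* A}
    (h : IsVarietyStr (specStr φ)) {ψ : A →+* B} (hψ : Function.Bijective ψ)
    (V : (Spec (CommRingCat.of A)).Opens) :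
    μ.opn (specStr φ) V =
      μ.opn (specStr (ψ.comp φ)) (Spec.map (CommRingCat.ofHom ψ) ⁻¹ᵁ V) := by
  have : IsIso (CommRingCat.ofHom ψ) := (ConcreteCategory.isIso_iff_bijective _).mpr hψ
  rw [← specMap_comp_specStr]
  refine μ.opn_eq_preimage h _ ?_
  rw [Scheme.Hom.opensRange_of_isIso]
  exact le_top

namespace ConeFormula

variable {k : Type u} [Field k] {R : Type v} [CommRing R] (μ : MotivicMeasure k R) {m : ℕ}
  {f₂ f₃ : MvPolynomial (Fin (m + 1)) k} (h₂ : f₂.IsHomogeneous 2) (h₃ : f₃.IsHomogeneous 3)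

lemma isHomogeneous (h₂ : f₂.IsHomogeneous 2) (h₃ : f₃.IsHomogeneous 3) :
    (X (Fin.last (m + 1)) * rename Fin.castSucc f₂ + rename Fin.castSucc f₃).IsHomogeneous 3 :=
  ((isHomogeneous_X k _).mul h₂.rename_isHomogeneous).add h₃.rename_isHomogeneous

include h₂ h₃

/-- The formula over a chart of the projective space parametrizing lines through the cone
point. -/
lemma chart {s h : MvPolynomial (Fin (m + 1)) k} {e : ℕ} (hs : s.IsHomogeneous 1)
    (hh : h.IsHomogeneous e) :
    μ.opn (ProjSpace.toSpec k (m + 1))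
        (ProjSpace.basicOpen (rename Fin.castSucc s * rename Fin.castSucc h)) =
      μ.opn (ProjSpace.toSpec k (m + 1))
        (ProjSpace.basicOpen (rename Fin.castSucc s * rename Fin.castSucc h) ⊓
          ProjSpace.basicOpen
            (X (Fin.last (m + 1)) * rename Fin.castSucc f₂ + rename Fin.castSucc f₃)) +
      μ.opn (ProjSpace.toSpec k m) (ProjSpace.basicOpen (s * h) ⊓ ProjSpace.basicOpen f₂) +
      μ.lef * (μ.opn (ProjSpace.toSpec k m) (ProjSpace.basicOpen (s * h)) -
        μ.opn (ProjSpace.toSpec k m) (ProjSpace.basicOpen (s * h) ⊓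
          (ProjSpace.basicOpen f₂ ⊔ ProjSpace.basicOpen f₃))) := by
  have hb : Function.Bijective (Chart.ofPolynomial hs hh) :=
    ⟨Chart.ofPolynomial_injective hs hh, Chart.ofPolynomial_surjective hs hh⟩
  have hft := Chart.finiteType_str (hs.mul hh)
  have hv : IsVarietyStr (specStr (Polynomial.C.comp (Chart.str (s * h)))) :=
    .specMap hft.polynomialC_comp
  have hv' : IsVarietyStr (specStr (Chart.str
      (rename (Fin.castSucc (n := m + 1)) s * rename Fin.castSucc h))) :=
    .specMap (Chart.finiteType_str (hs.rename_isHomogeneous.mul hh.rename_isHomogeneous))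
  have key := μ.cl_spec_polynomial_eq hft (Chart.dehom hs hh f₂) (Chart.dehom hs hh f₃)
  have hF : Polynomial.X * Polynomial.C (Chart.dehom hs hh f₂) +
      Polynomial.C (Chart.dehom hs hh f₃) = Chart.dehomLast hs hh
        (X (Fin.last (m + 1)) * rename Fin.castSucc f₂ + rename Fin.castSucc f₃) := by
    rw [map_add, map_mul, Chart.dehomLast_rename, Chart.dehomLast_rename, Chart.dehomLast_X_last]
  rw [μ.cl_eq_opn_top hv, μ.opn_specMap_bijective hv hb, μ.opn_specMap_bijective hv hb, hF,
    Chart.ofPolynomial_comp_C_comp_str, specMap_preimage_specBasicOpen,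
    Chart.ofPolynomial_dehomLast, Scheme.Hom.preimage_top,
    ← μ.cl_eq_opn_top hv'] at key
  rw [μ.opn_basicOpen hs.rename_isHomogeneous hh.rename_isHomogeneous, key,
    μ.opn_basicOpen_inf hs.rename_isHomogeneous hh.rename_isHomogeneous,
    Chart.toProj_preimage_basicOpen _ _ (isHomogeneous h₂ h₃) (by omega),
    μ.opn_basicOpen_inf hs hh, Chart.toProj_preimage_basicOpen _ _ h₂ (by omega),
    μ.opn_basicOpen hs hh, μ.opn_basicOpen_inf hs hh, Scheme.Hom.preimage_sup,
    Chart.toProj_preimage_basicOpen _ _ h₂ (by omega),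
    Chart.toProj_preimage_basicOpen _ _ h₃ (by omega)]

end ConeFormula

/-- A valuation on a distributive lattice that vanishes on a set closed under meets vanishes on
all finite joins of elements of that set. -/
lemma valuation_finset_sup_eq_zero {α R ι : Type*} [DistribLattice α] [OrderBot α]
    [AddCommGroup R] {δ : α → R} (hδ : ∀ a b, δ (a ⊔ b) + δ (a ⊓ b) = δ a + δ b)
    (h0 : δ ⊥ = 0) {B : Set α} (hB : ∀ b ∈ B, δ b = 0) (hinf : ∀ a ∈ B, ∀ b ∈ B, a ⊓ b ∈ B)
    (t : Finset ι) {f : ι → α} (hf : ∀ i, f i ∈ B) : δ (t.sup f) = 0 := by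
  classical
  induction t using Finset.induction_on generalizing f with
  | empty => simpa using h0
  | insert i t _ ih =>
    have h1 := hδ (f i) (t.sup f)
    rw [Finset.sup_inf_distrib_left, ih fun j ↦ hinf _ (hf i) _ (hf j), ih hf, hB _ (hf i)] at h1
    simpa using h1

lemma MvPolynomial.IsHomogeneous.mem_of_X_mem {σ k : Type*} [CommRing k] {p : MvPolynomial σ k}
    {d : ℕ} (hp : p.IsHomogeneous d) (hd : 0 < d) {I : Ideal (MvPolynomial σ k)}
    (hI : ∀ i, X i ∈ I) : p ∈ I := by
  have h1 : Ideal.span (X '' (Set.univ : Set σ)) ≤ I := by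
    rw [Ideal.span_le]
    rintro _ ⟨i, -, rfl⟩
    exact hI i
  refine h1 (mem_ideal_span_X_image.mpr fun t ht ↦ ?_)
  by_contra! H
  have : t = 0 := by ext i; simpa using H i
  subst this
  exact hd.ne (by simpa using hp.degree_eq_sum_deg_support ht |>.symm)

namespace ConeFormula

variable {k : Type u} [Field k] {R : Type v} [CommRing R] (μ : MotivicMeasure k R) {m : ℕ}
  {f₂ f₃ : MvPolynomial (Fin (m + 1)) k} (h₂ : f₂.IsHomogeneous 2) (h₃ : f₃.IsHomogeneous 3)

/-- The complement of the point `[0 : ⋯ : 0 : 1]`. -/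
def punctured (k : Type u) [Field k] (m : ℕ) : (ProjSpace k (m + 1)).Opens :=
  ⨆ j : Fin (m + 1), ProjSpace.basicOpen (X j.castSucc)

lemma opn_inf_valuation {X : Scheme.{u}} {s : X ⟶ SpecBase k} (h : IsVarietyStr s)
    (W V V' : X.Opens) :
    μ.opn s ((V ⊔ V') ⊓ W) + μ.opn s ((V ⊓ V') ⊓ W) = μ.opn s (V ⊓ W) + μ.opn s (V' ⊓ W) := by
  rw [inf_sup_right, inf_inf_distrib_right, μ.opn_sup_add_opn_inf h]

include h₂ h₃

lemma opn_punctured :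
    μ.opn (ProjSpace.toSpec k (m + 1)) (punctured k m) =
      μ.opn (ProjSpace.toSpec k (m + 1))
        (ProjSpace.basicOpen
          (X (Fin.last (m + 1)) * rename Fin.castSucc f₂ + rename Fin.castSucc f₃)) +
      μ.opn (ProjSpace.toSpec k m) (ProjSpace.basicOpen f₂) +
      μ.lef * (μ.opn (ProjSpace.toSpec k m) ⊤ - μ.opn (ProjSpace.toSpec k m)
        (ProjSpace.basicOpen f₂ ⊔ ProjSpace.basicOpen f₃)) := by
  set F := X (Fin.last (m + 1)) * rename Fin.castSucc f₂ + rename Fin.castSucc f₃ with hF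
  have hFle : ProjSpace.basicOpen F ≤ punctured k m := by
    intro x hx
    by_contra H
    refine hx ?_
    have hX (j : Fin (m + 1)) : X j.castSucc ∈ x.asHomogeneousIdeal := by
      by_contra hj
      exact H (TopologicalSpace.Opens.mem_iSup.mpr ⟨j, hj⟩)
    have hmem {p : MvPolynomial (Fin (m + 1)) k} {d : ℕ} (hp : p.IsHomogeneous d) (hd : 0 < d) :
        rename Fin.castSucc p ∈ x.asHomogeneousIdeal.toIdeal := by
      rw [← Ideal.mem_comap]
      exact hp.mem_of_X_mem hd fun j ↦ by simpa [Ideal.mem_comap] using hX j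
    exact Ideal.add_mem x.asHomogeneousIdeal.toIdeal
      (Ideal.mul_mem_left _ _ (hmem h₂ (by omega))) (hmem h₃ (by omega))
  let δ : (ProjSpace k m).Opens × (ProjSpace k (m + 1)).Opens → R := fun V ↦
    μ.opn (ProjSpace.toSpec k (m + 1)) V.2 -
      (μ.opn (ProjSpace.toSpec k (m + 1)) (V.2 ⊓ ProjSpace.basicOpen F) +
      μ.opn (ProjSpace.toSpec k m) (V.1 ⊓ ProjSpace.basicOpen f₂) +
      μ.lef * (μ.opn (ProjSpace.toSpec k m) V.1 -
        μ.opn (ProjSpace.toSpec k m)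
          (V.1 ⊓ (ProjSpace.basicOpen f₂ ⊔ ProjSpace.basicOpen f₃))))
  have hv := ProjSpace.isVarietyStr_toSpec (k := k) (n := m)
  have hv' := ProjSpace.isVarietyStr_toSpec (k := k) (n := m + 1)
  have hδ (V V') : δ (V ⊔ V') + δ (V ⊓ V') = δ V + δ V' := by
    simp only [δ, Prod.fst_sup, Prod.snd_sup, Prod.fst_inf, Prod.snd_inf]
    linear_combination μ.opn_sup_add_opn_inf hv' V.2 V'.2 -
      opn_inf_valuation μ hv' (ProjSpace.basicOpen F) V.2 V'.2 -
      opn_inf_valuation μ hv (ProjSpace.basicOpen f₂) V.1 V'.1 -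
      μ.lef * (μ.opn_sup_add_opn_inf hv V.1 V'.1 -
        opn_inf_valuation μ hv (ProjSpace.basicOpen f₂ ⊔ ProjSpace.basicOpen f₃) V.1 V'.1)
  have h0 : δ ⊥ = 0 := by
    simp [δ, μ.opn_bot hv, μ.opn_bot hv']
  let B : Set ((ProjSpace k m).Opens × (ProjSpace k (m + 1)).Opens) :=
    {V | ∃ (s h : MvPolynomial (Fin (m + 1)) k) (e : ℕ), s.IsHomogeneous 1 ∧ h.IsHomogeneous e ∧
      V = (ProjSpace.basicOpen (s * h),
        ProjSpace.basicOpen (rename Fin.castSucc s * rename Fin.castSucc h))}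
  have key := valuation_finset_sup_eq_zero hδ h0 (B := B) ?_ ?_ Finset.univ
    (f := fun j : Fin (m + 1) ↦ (ProjSpace.basicOpen (X j), ProjSpace.basicOpen (X j.castSucc))) ?_
  · rw [Finset.sup_univ_eq_iSup] at key
    simp only [δ, Prod.fst_iSup, Prod.snd_iSup, ProjSpace.iSup_basicOpen_X, top_inf_eq] at key
    rw [← punctured, inf_eq_right.mpr hFle, sub_eq_zero] at key
    exact key
  · rintro _ ⟨s, h, e, hs, hh, rfl⟩
    exact sub_eq_zero.mpr (chart μ h₂ h₃ hs hh)
  · rintro _ ⟨s, h, e, hs, hh, rfl⟩ _ ⟨t, g, d, ht, hg, rfl⟩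
    refine ⟨s, h * (t * g), _, hs, hh.mul (ht.mul hg), ?_⟩
    simp only [Prod.mk_inf_mk, map_mul, ProjSpace.basicOpen_mul, inf_assoc]
  · intro j
    exact ⟨X j, 1, 0, isHomogeneous_X _ _, isHomogeneous_one _ _, by simp⟩

end ConeFormula

namespace ConeFormula

variable {k : Type u} [Field k] {m : ℕ}

/-- The coordinates of the point `[0 : ⋯ : 0 : 1]`. -/
def point (k : Type u) [Field k] (m : ℕ) : Fin (m + 2) → k := Pi.single (Fin.last (m + 1)) 1

lemma point_last : point k m (Fin.last (m + 1)) = 1 := by simp [point]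

lemma point_castSucc (j : Fin (m + 1)) : point k m j.castSucc = 0 := by
  simp [point, (Fin.castSucc_lt_last j).ne]

/-- The evaluation of functions on the chart `D₊(xₙ)` at `[0 : ⋯ : 0 : 1]`. -/
def evalPoint (k : Type u) [Field k] (m : ℕ) :
    Chart (X (Fin.last (m + 1)) * 1 : MvPolynomial (Fin (m + 2)) k) →+* k :=
  (IsLocalization.Away.lift
    (S := Localization.Away (X (Fin.last (m + 1)) * 1 : MvPolynomial (Fin (m + 2)) k))
    (g := eval (point k m))
    (X (Fin.last (m + 1)) * 1) (by simp [point_last])).comp (algebraMap _ _)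

lemma evalPoint_mk {d : ℕ} (hd : (X (Fin.last (m + 1)) * 1 : MvPolynomial _ k).IsHomogeneous d)
    (n : ℕ) (x : MvPolynomial (Fin (m + 2)) k) (hx : x.IsHomogeneous (n * d)) :
    evalPoint k m (Chart.mk hd n x hx) = eval (point k m) x := by
  rw [evalPoint, RingHom.comp_apply, HomogeneousLocalization.algebraMap_apply, Chart.val_mk,
    Localization.mk_eq_mk', IsLocalization.Away.lift, IsLocalization.lift_mk'_spec]
  simp [point_last]

lemma evalPoint_comp_str : (evalPoint k m).comp (Chart.str _) = RingHom.id k := by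
  ext c
  rw [RingHom.comp_apply, Chart.str_eq_mk ((isHomogeneous_X k _).mul (isHomogeneous_one _ _)),
    evalPoint_mk]
  simp

/-- The dehomogenization at the last coordinate. -/
abbrev dehomPoint (k : Type u) [Field k] (m : ℕ) :
    MvPolynomial (Fin (m + 2)) k →+*
      Chart (X (Fin.last (m + 1)) * 1 : MvPolynomial (Fin (m + 2)) k) :=
  Chart.dehom (isHomogeneous_X k _) (isHomogeneous_one _ _)

lemma evalPoint_dehomPoint (x : MvPolynomial (Fin (m + 2)) k) :
    evalPoint k m (dehomPoint k m x) = eval (point k m) x := by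
  suffices (evalPoint k m).comp (dehomPoint k m) = eval (point k m) from congr($this x)
  ext i
  · simpa [Chart.dehom_C] using congr($evalPoint_comp_str _)
  · simp [Chart.dehom, evalPoint_mk]

lemma dehomPoint_X_last : dehomPoint k m (X (Fin.last (m + 1))) = 1 := by
  apply HomogeneousLocalization.val_injective
  rw [dehomPoint, Chart.dehom, eval₂Hom_X', Chart.val_mk, HomogeneousLocalization.val_one,
    ← Localization.mk_self (⟨_, 1, pow_one _⟩ :
      Submonoid.powers (X (Fin.last (m + 1)) * 1 : MvPolynomial (Fin (m + 2)) k))]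
  congr 1
  simp

lemma ker_evalPoint_le_iff (p : PrimeSpectrum
    (Chart (X (Fin.last (m + 1)) * 1 : MvPolynomial (Fin (m + 2)) k))) :
    RingHom.ker (evalPoint k m) ≤ p.asIdeal ↔
      ∀ j : Fin (m + 1), dehomPoint k m (X j.castSucc) ∈ p.asIdeal := by
  constructor
  · intro h j
    exact h (by simp [RingHom.mem_ker, evalPoint_dehomPoint, point_castSucc])
  · intro h a ha
    obtain ⟨x, n, rfl⟩ := Chart.exists_eq_dehom_mul (isHomogeneous_X k _) (isHomogeneous_one _ _) a
    refine p.asIdeal.mul_mem_right _ ?_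
    have hx : eval (point k m) x = 0 := by
      rw [RingHom.mem_ker, map_mul, evalPoint_dehomPoint, map_pow] at ha
      refine (mul_eq_zero.mp ha).resolve_right (pow_ne_zero _ ?_)
      simp [Chart.unit, evalPoint_mk, point_last]
    have hd : (Ideal.Quotient.mk p.asIdeal).comp (dehomPoint k m) =
        ((Ideal.Quotient.mk p.asIdeal).comp (Chart.str _)).comp (eval (point k m)) := by
      ext i
      · simp [Chart.dehom_C]
      · induction i using Fin.lastCases with
        | last => simp [dehomPoint_X_last, point_last]
        | cast i => simpa [point_castSucc] using Ideal.Quotient.eq_zero_iff_mem.mpr (h i)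
    rw [← Ideal.Quotient.eq_zero_iff_mem]
    simpa [hx] using congr($hd x)

variable {R : Type v} [CommRing R] (μ : MotivicMeasure k R)

lemma opn_top_eq_opn_punctured_add_one :
    μ.opn (ProjSpace.toSpec k (m + 1)) ⊤ =
      μ.opn (ProjSpace.toSpec k (m + 1)) (punctured k m) + 1 := by
  have hs := isHomogeneous_X k (Fin.last (m + 1))
  have hh := isHomogeneous_one (Fin (m + 2)) k
  have hv := ProjSpace.isVarietyStr_toSpec (k := k) (n := m + 1)
  have htop : ProjSpace.basicOpen (X (Fin.last (m + 1)) * 1) ⊔ punctured k m = ⊤ := by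
    rw [mul_one, eq_top_iff, ← ProjSpace.iSup_basicOpen_X, iSup_le_iff]
    intro i
    induction i using Fin.lastCases with
    | last => exact le_sup_left
    | cast i =>
      exact (le_iSup (fun j : Fin (m + 1) ↦ ProjSpace.basicOpen (k := k) (X j.castSucc)) i).trans
        le_sup_right
  have h1 := μ.opn_sup_add_opn_inf hv (ProjSpace.basicOpen (X (Fin.last (m + 1)) * 1))
    (punctured k m)
  have hpre : Chart.toProj hs hh ⁻¹ᵁ punctured k m =
      ⨆ j : Fin (m + 1), specBasicOpen (dehomPoint k m (X j.castSucc)) := by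
    rw [punctured, Scheme.Hom.preimage_iSup]
    exact iSup_congr fun j ↦ Chart.toProj_preimage_basicOpen _ _ (isHomogeneous_X k _) one_pos
  rw [htop, μ.opn_basicOpen_inf hs hh, μ.opn_basicOpen hs hh,
    μ.cl_spec_eq_opn_add (.specMap (Chart.finiteType_str (hs.mul hh))) (ψ := evalPoint k m)
      (V := Chart.toProj hs hh ⁻¹ᵁ punctured k m) (fun c ↦ ⟨_, congr($evalPoint_comp_str c)⟩) ?_,
    evalPoint_comp_str] at h1
  · have h2 : μ.cl _ (specStr (RingHom.id k)) = 1 := by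
      refine Eq.trans ?_ μ.cl_point
      congr 1
      exact Spec.map_id _
    rw [h2] at h1
    linear_combination h1
  · intro p
    rw [hpre, ker_evalPoint_le_iff]
    refine TopologicalSpace.Opens.mem_iSup.trans ?_
    push Not
    rfl

end ConeFormula

/-- If all partial derivatives of `xₙ² f₁ + xₙ f₂ + f₃` vanish at `[0 : ⋯ : 0 : 1]`, then the
linear form `f₁` vanishes. -/
lemma linear_form_eq_zero {k : Type u} [Field k] {m : ℕ} {f₁ f₂ f₃ : MvPolynomial (Fin (m + 1)) k}
    (h₁ : f₁.IsHomogeneous 1) (h₂ : f₂.IsHomogeneous 2) (h₃ : f₃.IsHomogeneous 3)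
    (hsing : ∀ i, eval (ConeFormula.point k m) (pderiv i (X (Fin.last (m + 1)) ^ 2 *
      rename Fin.castSucc f₁ + X (Fin.last (m + 1)) * rename Fin.castSucc f₂ +
      rename Fin.castSucc f₃)) = 0) : f₁ = 0 := by
  have hcomp : ConeFormula.point k m ∘ Fin.castSucc = 0 := by
    ext j
    simp [ConeFormula.point_castSucc]
  have hpos {p : MvPolynomial (Fin (m + 1)) k} {d : ℕ} (hp : p.IsHomogeneous d) (hd : d ≠ 0) :
      eval (0 : Fin (m + 1) → k) p = 0 := by
    simpa [constantCoeff_eq] using hp.coeff_eq_zero (d := 0) (by simpa using hd.symm)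
  have hder (i : Fin (m + 1)) : pderiv i f₁ = 0 := by
    have h := hsing i.castSucc
    have hinj := Fin.castSucc_injective (m + 1)
    simp only [map_add, Derivation.leibniz, Derivation.leibniz_pow, pderiv_X,
      pderiv_rename hinj, smul_eq_mul, map_mul, map_pow, eval_X, eval_rename, hcomp,
      ConeFormula.point_last] at h
    rw [hpos h₁ one_ne_zero, hpos h₂ two_ne_zero, hpos (h₂.pderiv (i := i)) (by norm_num),
      hpos (h₃.pderiv (i := i)) (by norm_num)] at h
    have h0 : (pderiv i f₁).IsHomogeneous 0 := h₁.pderiv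
    rw [totalDegree_eq_zero_iff_eq_C.mp (Nat.le_zero.mp h0.totalDegree_le)] at h ⊢
    simp at h
    simp [h]
  have := h₁.sum_X_mul_pderiv
  simpa [hder] using this.symm

namespace IsProjSubvariety

variable {k : Type u} [Field k] {R : Type v} [CommRing R] (μ : MotivicMeasure k R) {n : ℕ}
  {S : Set (MvPolynomial (Fin (n + 1)) k)} {Y : Scheme.{u}} {sY : Y ⟶ SpecBase k}

lemma cl_eq (h : IsProjSubvariety k n S Y sY) {V : (ProjSpace k n).Opens}
    (hV : (V : Set (ProjSpace k n)) =
      (ProjectiveSpectrum.zeroLocus (homogeneousSubmodule (Fin (n + 1)) k) S)ᶜ) :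
    μ.cl Y sY = μ.opn (ProjSpace.toSpec k n) ⊤ - μ.opn (ProjSpace.toSpec k n) V := by
  obtain ⟨-, i, hi, rfl, hr⟩ := h
  rw [eq_sub_iff_add_eq', ← μ.cl_eq_opn_top ProjSpace.isVarietyStr_toSpec]
  exact (μ.cl_eq_opn_add ProjSpace.isVarietyStr_toSpec i (hV.trans congr($(hr)ᶜ).symm)).symm

end IsProjSubvariety

lemma ProjSpace.coe_basicOpen {k : Type u} [Field k] {n : ℕ} (g : MvPolynomial (Fin (n + 1)) k) :
    (ProjSpace.basicOpen g : Set (ProjSpace k n)) =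
      (ProjectiveSpectrum.zeroLocus (homogeneousSubmodule (Fin (n + 1)) k) {g})ᶜ :=
  ProjectiveSpectrum.basicOpen_eq_zeroLocus_compl _ _

lemma ProjSpace.coe_basicOpen_sup {k : Type u} [Field k] {n : ℕ}
    (g g' : MvPolynomial (Fin (n + 1)) k) :
    ((ProjSpace.basicOpen g ⊔ ProjSpace.basicOpen g' : (ProjSpace k n).Opens) :
      Set (ProjSpace k n)) =
      (ProjectiveSpectrum.zeroLocus (homogeneousSubmodule (Fin (n + 1)) k) {g, g'})ᶜ := by
  refine (congrArg₂ (· ∪ ·) (coe_basicOpen g) (coe_basicOpen g')).trans ?_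
  refine (Set.compl_inter _ _).symm.trans (congrArg _ ?_)
  exact (ProjectiveSpectrum.zeroLocus_union _ {g} {g'}).symm

end

/-- Let `X = V(f) ⊂ ℙⁿ_k` (here `n = m + 1 ≥ 1`) be a cubic hypersurface
over a field `k` with a singular `k`-rational point at `[0 : ⋯ : 0 : 1]`, so that
`f = xₙ²·f₁ + xₙ·f₂ + f₃` with `fᵢ ∈ k[x₀, …, x_{n-1}]` homogeneous of degree `i`.  Then
`f₁ = 0`, and `[X] = 1 + [ℙ^{n-1}_k ∖ V(f₂)] + 𝕃·[V(f₂, f₃)]` in `K₀(Var_k)`, where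
`ℙ^{n-1}_k ∖ V(f₂)` is the complementary open subscheme of `V(f₂) ⊂ ℙ^{n-1}_k` and
`V(f₂, f₃) ⊂ ℙ^{n-1}_k`. -/
theorem singular_cubic_class_formula (k : Type u) [Field k] (m : ℕ)
    (f : MvPolynomial (Fin (m + 2)) k)
    (f₁ f₂ f₃ : MvPolynomial (Fin (m + 1)) k)
    (h₁ : f₁.IsHomogeneous 1) (h₂ : f₂.IsHomogeneous 2) (h₃ : f₃.IsHomogeneous 3)
    (hf : f = X (Fin.last (m + 1)) ^ 2 * rename Fin.castSucc f₁
      + X (Fin.last (m + 1)) * rename Fin.castSucc f₂ + rename Fin.castSucc f₃)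
    -- `[0 : ⋯ : 0 : 1]` is a singular point of `X = V(f)`
    (hsing : ∀ i, MvPolynomial.eval (Pi.single (Fin.last (m + 1)) 1)
      (MvPolynomial.pderiv i f) = 0)
    (Xs : Scheme.{u}) (sX : Xs ⟶ SpecBase k)
    (hX : IsProjSubvariety k (m + 1) {f} Xs sX)
    -- `W = V(f₂, f₃) ⊂ ℙ^{n-1}_k`
    (W : Scheme.{u}) (sW : W ⟶ SpecBase k)
    (hW : IsProjSubvariety k m {f₂, f₃} W sW)
    -- `U = ℙ^{n-1}_k ∖ V(f₂)`, the complementary open subscheme of `V(f₂)`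
    (U : (ProjSpace k m).Opens)
    (hU : (U : Set (ProjSpace k m)) =
      (ProjectiveSpectrum.zeroLocus (homogeneousSubmodule (Fin (m + 1)) k) {f₂})ᶜ) :
    f₁ = 0 ∧
    ∀ (R : Type u) [CommRing R] (μ : MotivicMeasure k R),
      μ.cl Xs sX = 1 + μ.cl U.toScheme (U.ι ≫ ProjSpace.toSpec k m) + μ.lef * μ.cl W sW := by
  subst hf
  have hf₁ : f₁ = 0 := linear_form_eq_zero h₁ h₂ h₃ hsing
  refine ⟨hf₁, fun R _ μ ↦ ?_⟩
  subst hf₁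
  obtain rfl : U = ProjSpace.basicOpen f₂ :=
    TopologicalSpace.Opens.ext (hU.trans (ProjSpace.coe_basicOpen f₂).symm)
  rw [map_zero, mul_zero, zero_add] at hX
  rw [hX.cl_eq μ (ProjSpace.coe_basicOpen _), ConeFormula.opn_top_eq_opn_punctured_add_one,
    ConeFormula.opn_punctured μ h₂ h₃,
    hW.cl_eq μ (V := ProjSpace.basicOpen f₂ ⊔ ProjSpace.basicOpen f₃) ?_]
  · change _ = 1 + μ.opn (ProjSpace.toSpec k m) (ProjSpace.basicOpen f₂) + _
    ring
  · exact ProjSpace.coe_basicOpen_sup f₂ f₃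
end
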